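/- arXiv:2306.12171 — 5 statements merged into one kernel-verified Lean document; each statement's English description precedes it below -/
import Mathlib

section
/- Let γ : 𝕊¹ → ℝ² be a C¹ immersed closed curve (γ'(t) ≠ 0 for all t) all of whose self-intersection points are transverse, and with only finitely many self-intersection points, each having a finite fiber γ⁻¹(p). Let W be the union of Image(γ) together with all bounded connected components of ℝ² \ Image(γ). Then W is compact, connected, and simply connected. -/
open Set Function Bornology

section FillingLoops

open Filter Topology Metric

section Filled

variable {E : Type*} [NormedAddCommGroup E]

/-- A set together with the bounded components of its complement. -/
def filled (K : Set E) : Set E :=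
  K ∪ {x | x ∈ Kᶜ ∧ IsBounded (connectedComponentIn Kᶜ x)}

/-- Nearby points of `W` are joined by small paths in `W`, uniformly. -/
def UniformlyLocallyJoined (W : Set E) : Prop :=
  ∀ ε > 0, ∃ δ > 0, ∀ x ∈ W, ∀ y ∈ W, dist x y < δ → JoinedIn (W ∩ closedBall x ε) x y

lemma subset_filled (K : Set E) : K ⊆ filled K := subset_union_left

lemma mem_compl_filled {K : Set E} {x : E} :
    x ∈ (filled K)ᶜ ↔ x ∉ K ∧ ¬ IsBounded (connectedComponentIn Kᶜ x) := by
  simp only [filled, mem_compl_iff, mem_union, mem_ofPred_eq, not_or, not_and]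
  tauto

lemma connectedComponentIn_subset_compl_filled {K : Set E} {x : E} (hx : x ∈ (filled K)ᶜ) :
    connectedComponentIn Kᶜ x ⊆ (filled K)ᶜ := by
  intro y hy
  rw [mem_compl_filled] at hx ⊢
  exact ⟨connectedComponentIn_subset _ _ hy, connectedComponentIn_eq hy ▸ hx.2⟩

lemma not_mem_filled_of_unbounded {K C : Set E} {x : E} (hC : IsPreconnected C) (hx : x ∈ C)
    (hCK : C ⊆ Kᶜ) (hCb : ¬ IsBounded C) : x ∈ (filled K)ᶜ :=
  mem_compl_filled.2 ⟨hCK hx, fun h => hCb (h.subset (hC.subset_connectedComponentIn hx hCK))⟩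

lemma IsPreconnected.subset_filled {K C : Set E} (hC : IsPreconnected C) {x : E} (hx : x ∈ C)
    (hxK : x ∈ filled K) (hCK : C ⊆ Kᶜ) : C ⊆ filled K := by
  intro y hy
  by_contra hy'
  have h1 := hC.subset_connectedComponentIn hy hCK hx
  exact connectedComponentIn_subset_compl_filled hy' h1 hxK

lemma filled_subset_filled {A B : Set E} (h : A ⊆ filled B) : filled A ⊆ filled B := by
  rw [← compl_subset_compl]
  intro x hx
  exact not_mem_filled_of_unbounded isPreconnected_connectedComponentIn
    (mem_connectedComponentIn (mem_compl_filled.1 hx).1)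
    ((connectedComponentIn_subset_compl_filled hx).trans (compl_subset_compl.2 h))
    (mem_compl_filled.1 hx).2

lemma uniformlyLocallyJoined_image {β : ℝ → E} (hβ : ContinuousOn β (Icc 0 1)) :
    UniformlyLocallyJoined (β '' Icc 0 1) := by
  intro ε hε
  by_contra! hcon
  have hu : ∀ n : ℕ, (0 : ℝ) < 1 / (n + 1) := fun n => by positivity
  choose x hx y hy hxy hj using fun n : ℕ => hcon _ (hu n)
  choose s hs hsx using hx
  choose t ht hty using hy
  obtain ⟨⟨a, b⟩, hab, φ, hφ, hlim⟩ :=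
    (isCompact_Icc.prod isCompact_Icc).tendsto_subseq (x := fun n => (s n, t n))
      fun n => mk_mem_prod (hs n) (ht n)
  have hsl : Tendsto (fun n => s (φ n)) atTop (𝓝[Icc 0 1] a) :=
    tendsto_nhdsWithin_iff.2 ⟨(continuous_fst.tendsto _).comp hlim, .of_forall fun n => hs _⟩
  have htl : Tendsto (fun n => t (φ n)) atTop (𝓝[Icc 0 1] b) :=
    tendsto_nhdsWithin_iff.2 ⟨(continuous_snd.tendsto _).comp hlim, .of_forall fun n => ht _⟩
  have heq : β a = β b := by
    have h1 : Tendsto (fun n => dist (x (φ n)) (y (φ n))) atTop (𝓝 (dist (β a) (β b))) := by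
      simp only [← hsx, ← hty]
      exact ((hβ a hab.1).tendsto.comp hsl).dist ((hβ b hab.2).tendsto.comp htl)
    have h2 : Tendsto (fun n => dist (x (φ n)) (y (φ n))) atTop (𝓝 0) :=
      squeeze_zero (fun _ => dist_nonneg) (fun n => (hxy _).le)
        (tendsto_one_div_add_atTop_nhds_zero_nat.comp hφ.tendsto_atTop)
    exact dist_eq_zero.1 (tendsto_nhds_unique h1 h2)
  have hloc : ∀ c ∈ Icc (0 : ℝ) 1, ∀ᶠ u in 𝓝[Icc 0 1] c,
      JoinedIn (β '' Icc 0 1 ∩ closedBall (β c) (ε / 2)) (β u) (β c) := by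
    intro c hc
    obtain ⟨r, hr, hrb⟩ := Metric.mem_nhdsWithin_iff.1
      ((hβ c hc) (closedBall_mem_nhds (β c) (half_pos hε)))
    have hconv : Convex ℝ (ball c r ∩ Icc 0 1) := (convex_ball _ _).inter (convex_Icc _ _)
    have hpc := (hconv.isPathConnected ⟨c, mem_ball_self hr, hc⟩).image'
      (hβ.mono inter_subset_right)
    refine eventually_nhdsWithin_iff.2 (eventually_of_mem (ball_mem_nhds c hr) fun u hu hu' => ?_)
    refine (hpc.joinedIn _ ⟨u, ⟨hu, hu'⟩, rfl⟩ _ ⟨c, ⟨mem_ball_self hr, hc⟩, rfl⟩).mono ?_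
    rintro _ ⟨v, hv, rfl⟩
    exact ⟨⟨v, hv.2, rfl⟩, hrb hv⟩
  obtain ⟨n, hn1, hn2⟩ :=
    ((hsl.eventually (hloc a hab.1)).and (htl.eventually (hloc b hab.2))).exists
  rw [hsx] at hn1
  rw [← heq, hty] at hn2
  refine hj (φ n) ((hn1.trans hn2.symm).mono ?_)
  rintro z ⟨hz1, hz2⟩
  have h3 : dist (x (φ n)) (β a) ≤ ε / 2 := hn1.source_mem.2
  have h4 : dist z (β a) ≤ ε / 2 := hz2
  exact ⟨hz1, mem_closedBall.2 (by linarith [dist_triangle_right z (x (φ n)) (β a)])⟩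

variable [NormedSpace ℝ E]

lemma filled_subset_closedBall {K : Set E} {z : E} {r : ℝ} (h : K ⊆ closedBall z r) (hr : 0 ≤ r) :
    filled K ⊆ closedBall z r := by
  rw [← compl_subset_compl]
  intro x hx
  have hx' : r < ‖x - z‖ := by simpa [dist_eq_norm] using hx
  have hpos : 0 < ‖x - z‖ := hr.trans_lt hx'
  have hnorm : ∀ t ∈ Ici (0 : ℝ), ‖x + t • (x - z) - z‖ = (1 + t) * ‖x - z‖ := by
    intro t ht
    have : x + t • (x - z) - z = (1 + t) • (x - z) := by rw [add_smul, one_smul]; abel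
    rw [this, norm_smul, Real.norm_of_nonneg (by have := mem_Ici.1 ht; linarith)]
  refine not_mem_filled_of_unbounded (C := (fun t : ℝ => x + t • (x - z)) '' Ici 0)
    (isPreconnected_Ici.image _ (by fun_prop)) ⟨0, by simp, by simp⟩ ?_ ?_
  · rintro _ ⟨t, ht, rfl⟩ hK
    have h1 := h hK
    rw [mem_closedBall, dist_eq_norm, hnorm t ht] at h1
    nlinarith [mem_Ici.1 ht]
  · intro hb
    obtain ⟨R, hR⟩ := hb.subset_closedBall z
    have h1 := hR ⟨max 0 (R / ‖x - z‖), mem_Ici.2 (le_max_left _ _), rfl⟩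
    rw [mem_closedBall, dist_eq_norm, hnorm _ (mem_Ici.2 (le_max_left _ _))] at h1
    have h2 : R / ‖x - z‖ * ‖x - z‖ = R := div_mul_cancel₀ _ hpos.ne'
    nlinarith [le_max_right 0 (R / ‖x - z‖)]

lemma isOpen_compl_filled {K : Set E} (hK : IsClosed K) : IsOpen (filled K)ᶜ := by
  rw [isOpen_iff_mem_nhds]
  intro x hx
  exact mem_of_superset ((hK.isOpen_compl.connectedComponentIn).mem_nhds
    (mem_connectedComponentIn (mem_compl_filled.1 hx).1))
    (connectedComponentIn_subset_compl_filled hx)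

lemma isClosed_filled {K : Set E} (hK : IsClosed K) : IsClosed (filled K) :=
  isOpen_compl_iff.1 (isOpen_compl_filled hK)

lemma isBounded_filled {K : Set E} (hK : IsBounded K) : IsBounded (filled K) := by
  obtain ⟨R, hR⟩ := hK.subset_closedBall 0
  exact isBounded_closedBall.subset
    (filled_subset_closedBall (hR.trans (closedBall_subset_closedBall (le_max_left R 0)))
      (le_max_right R 0))

lemma isPreconnected_compl_closedBall (h : 1 < Module.rank ℝ E) (z : E) (r : ℝ) :
    IsPreconnected (closedBall z r)ᶜ := by
  rcases lt_or_ge r 0 with hr | hr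
  · simpa [closedBall_eq_empty.2 hr] using isPreconnected_univ
  have himg : (closedBall z r)ᶜ =
      (fun p : ℝ × E => z + p.1 • p.2) '' (Ioi r ×ˢ sphere (0 : E) 1) := by
    ext x
    constructor
    · intro hx
      have hx' : r < ‖x - z‖ := by simpa [dist_eq_norm] using hx
      have hpos : 0 < ‖x - z‖ := hr.trans_lt hx'
      refine ⟨(‖x - z‖, ‖x - z‖⁻¹ • (x - z)), ⟨hx', ?_⟩, ?_⟩
      · simp [norm_smul, hpos.ne']
      · simp [smul_smul, hpos.ne']
    · rintro ⟨⟨t, u⟩, ⟨ht, hu⟩, rfl⟩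
      have ht' : r < t := ht
      have hu' : ‖u‖ = 1 := by simpa using hu
      simp [norm_smul, hu', abs_of_pos (hr.trans_lt ht'), ht']
  rw [himg]
  exact (isPreconnected_Ioi.prod (isPreconnected_sphere h _ _)).image _ (by fun_prop)

lemma isPreconnected_compl_filled (h : 1 < Module.rank ℝ E) {K : Set E} (hK : IsBounded K) :
    IsPreconnected (filled K)ᶜ := by
  obtain ⟨R, hR⟩ := hK.subset_closedBall 0
  have hc := isPreconnected_compl_closedBall h (0 : E) R
  have key : ∀ x ∈ (filled K)ᶜ, ∃ y ∈ (closedBall (0 : E) R)ᶜ, y ∈ connectedComponentIn Kᶜ x := by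
    intro x hx
    by_contra! hcon
    exact (mem_compl_filled.1 hx).2 (isBounded_closedBall.subset
      fun y hy => by_contra fun hy' => hcon y hy' hy)
  refine isPreconnected_of_forall_pair fun x hx y hy => ?_
  obtain ⟨a, ha, hax⟩ := key x hx
  obtain ⟨b, hb, hby⟩ := key y hy
  have hab : connectedComponentIn Kᶜ a = connectedComponentIn Kᶜ b :=
    connectedComponentIn_eq (hc.subset_connectedComponentIn ha (compl_subset_compl.2 hR) hb)
  have hxy : connectedComponentIn Kᶜ x = connectedComponentIn Kᶜ y := by
    rw [connectedComponentIn_eq hax, hab, connectedComponentIn_eq hby]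
  exact ⟨_, connectedComponentIn_subset_compl_filled hx,
    mem_connectedComponentIn (mem_compl_filled.1 hx).1,
    hxy ▸ mem_connectedComponentIn (mem_compl_filled.1 hy).1, isPreconnected_connectedComponentIn⟩

lemma joinedIn_filled_of_segment_inter {K : Set E} (hK : IsClosed K) {x y : E}
    (hx : x ∈ filled K) (h : ¬ Disjoint (segment ℝ x y) K) :
    ∃ a ∈ K, a ∈ segment ℝ x y ∧ JoinedIn (filled K ∩ segment ℝ x y) x a := by
  set l : ℝ → E := fun t => AffineMap.lineMap x y t with hl
  have hlc : Continuous l := AffineMap.lineMap_continuous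
  have hseg : segment ℝ x y = l '' Icc 0 1 := segment_eq_image_lineMap ℝ x y
  have hTc : IsCompact (Icc (0 : ℝ) 1 ∩ l ⁻¹' K) := isCompact_Icc.inter_right (hK.preimage hlc)
  have hTn : (Icc (0 : ℝ) 1 ∩ l ⁻¹' K).Nonempty := by
    obtain ⟨z, hz, hzK⟩ := not_disjoint_iff.1 h
    rw [hseg] at hz
    obtain ⟨t, ht, rfl⟩ := hz
    exact ⟨t, ht, hzK⟩
  obtain ⟨t₀, ⟨ht₀, ht₀K⟩, hmin⟩ := hTc.exists_isLeast hTn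
  have h0 : l 0 = x := AffineMap.lineMap_apply_zero x y
  refine ⟨l t₀, ht₀K, hseg ▸ mem_image_of_mem l ht₀, ?_⟩
  have hpc : IsPathConnected (l '' Icc 0 t₀) :=
    ((convex_Icc 0 t₀).isPathConnected ⟨0, by simp [ht₀.1]⟩).image hlc
  refine (hpc.joinedIn x ⟨0, ⟨le_rfl, ht₀.1⟩, h0⟩ _ ⟨t₀, ⟨ht₀.1, le_rfl⟩, rfl⟩).mono ?_
  rintro _ ⟨t, ht, rfl⟩
  have ht1 : t ∈ Icc (0 : ℝ) 1 := ⟨ht.1, ht.2.trans ht₀.2⟩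
  refine ⟨?_, hseg ▸ mem_image_of_mem l ht1⟩
  rcases ht.2.eq_or_lt with rfl | hlt
  · exact subset_filled K ht₀K
  · refine IsPreconnected.subset_filled (C := l '' Icc 0 t) (isPreconnected_Icc.image _ hlc.continuousOn)
      ⟨0, ⟨le_rfl, ht.1⟩, h0⟩ hx ?_ ⟨t, ⟨ht.1, le_rfl⟩, rfl⟩
    rintro _ ⟨s, hs, rfl⟩ hsK
    exact absurd (hmin ⟨⟨hs.1, hs.2.trans ht1.2⟩, hsK⟩) (not_le.2 (hs.2.trans_lt hlt))

lemma uniformlyLocallyJoined_filled {K : Set E} (hK : IsClosed K)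
    (h : UniformlyLocallyJoined K) : UniformlyLocallyJoined (filled K) := by
  intro ε hε
  obtain ⟨δ, hδ, hj⟩ := h (ε / 2) (half_pos hε)
  refine ⟨min δ (ε / 2), lt_min hδ (half_pos hε), fun x hx y hy hxy => ?_⟩
  have hxyδ := hxy.trans_le (min_le_left _ _)
  have hxyε := hxy.trans_le (min_le_right _ _)
  have hseg : segment ℝ x y ⊆ closedBall x (ε / 2) :=
    (convex_closedBall x _).segment_subset (mem_closedBall_self (half_pos hε).le)
      (by rw [mem_closedBall, dist_comm]; exact hxyε.le)
  have hball : closedBall x (ε / 2) ⊆ closedBall x ε := closedBall_subset_closedBall (by linarith)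
  by_cases hd : Disjoint (segment ℝ x y) K
  · refine JoinedIn.of_segment_subset fun z hz => ⟨?_, hball (hseg hz)⟩
    exact IsPreconnected.subset_filled (convex_segment x y).isPreconnected
      (left_mem_segment ℝ x y) hx hd.subset_compl_right hz
  · obtain ⟨a, haK, has, ha⟩ := joinedIn_filled_of_segment_inter hK hx hd
    obtain ⟨b, hbK, hbs, hb⟩ := joinedIn_filled_of_segment_inter hK hy (segment_symm ℝ x y ▸ hd)
    rw [← segment_symm ℝ x y] at hbs hb
    have hab : dist a b < δ := by
      have hx' : x ∈ closedBall a (dist x y) :=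
        mem_closedBall_comm.1 (segment_subset_closedBall_left x y has)
      have hy' : y ∈ closedBall a (dist x y) :=
        mem_closedBall_comm.1 (segment_subset_closedBall_right x y has)
      rw [dist_comm]
      exact ((convex_closedBall a _).segment_subset hx' hy' hbs).trans_lt hxyδ
    have hm : filled K ∩ segment ℝ x y ⊆ filled K ∩ closedBall x ε :=
      inter_subset_inter_right _ (hseg.trans hball)
    refine ((ha.mono hm).trans ((hj a haK b hbK hab).mono ?_)).trans (hb.mono hm).symm
    rintro z ⟨hz1, hz2⟩
    have h1 : dist a x ≤ ε / 2 := hseg has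
    have h2 : dist z a ≤ ε / 2 := hz2
    exact ⟨subset_filled K hz1, mem_closedBall.2 (by linarith [dist_triangle z a x])⟩

lemma isPathConnected_filled {K : Set E} (hK : IsClosed K) (h : IsPathConnected K) :
    IsPathConnected (filled K) := by
  obtain ⟨k, hk⟩ := h.nonempty
  refine ⟨k, subset_filled K hk, fun {x} hx => ?_⟩
  obtain ⟨a, haK, -, ha⟩ := joinedIn_filled_of_segment_inter hK hx
    (not_disjoint_iff.2 ⟨k, right_mem_segment ℝ x k, hk⟩)
  exact ((h.joinedIn k hk a haK).mono (subset_filled K)).trans (ha.mono inter_subset_left).symm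

end Filled

section Push

variable {E : Type*} [NormedAddCommGroup E] [NormedSpace ℝ E]

lemma isPreconnected_ball_diff_center (h : 1 < Module.rank ℝ E) (p : E) (r : ℝ) :
    IsPreconnected (ball p r \ {p}) := by
  have himg : ball p r \ {p} = (fun q : ℝ × E => p + q.1 • q.2) '' (Ioo 0 r ×ˢ sphere (0 : E) 1) := by
    ext x
    constructor
    · rintro ⟨hx, hxp⟩
      have hpos : 0 < ‖x - p‖ := norm_pos_iff.2 (sub_ne_zero.2 hxp)
      refine ⟨(‖x - p‖, ‖x - p‖⁻¹ • (x - p)), ⟨⟨hpos, mem_ball_iff_norm.1 hx⟩, ?_⟩, ?_⟩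
      · simp [norm_smul, hpos.ne']
      · simp [smul_smul, hpos.ne']
    · rintro ⟨⟨t, u⟩, ⟨ht, hu⟩, rfl⟩
      have ht' : 0 < t ∧ t < r := ht
      have hu' : ‖u‖ = 1 := by simpa using hu
      have hu0 : u ≠ 0 := by rintro rfl; simp at hu'
      simp [norm_smul, hu', abs_of_pos ht'.1, ht'.2, ht'.1.ne', hu0]
  rw [himg]
  exact (isPreconnected_Ioo.prod (isPreconnected_sphere h _ _)).image _ (by fun_prop)

lemma IsPreconnected.diff_singleton (h : 1 < Module.rank ℝ E) {V : Set E} (hV : IsOpen V)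
    (hc : IsPreconnected V) (p : E) : IsPreconnected (V \ {p}) := by
  by_cases hp : p ∈ V
  swap
  · rwa [sdiff_singleton_eq_self hp]
  obtain ⟨r, hr, hrV⟩ := Metric.isOpen_iff.1 hV p hp
  have hb := isPreconnected_ball_diff_center h p r
  have hbV : ball p r \ {p} ⊆ V \ {p} := sdiff_subset_sdiff_left hrV
  rw [isPreconnected_iff_subset_of_disjoint] at hc hb ⊢
  have key : ∀ u v : Set E, IsOpen u → IsOpen v → V \ {p} ⊆ u ∪ v →
      V \ {p} ∩ (u ∩ v) = ∅ → ball p r \ {p} ⊆ u → V \ {p} ⊆ u := by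
    intro u v hu hv huv hd hbu
    have hd' : ∀ z ∈ V \ {p}, z ∈ u → z ∉ v := fun z hz hzu hzv =>
      (eq_empty_iff_forall_notMem.1 hd) z ⟨hz, hzu, hzv⟩
    have := hc (u ∪ ball p r) (v \ {p}) (hu.union isOpen_ball)
      (hv.sdiff isClosed_singleton) ?_ ?_
    · rcases this with h1 | h1
      · intro z hz
        exact (h1 hz.1).elim id fun hzb => hbu ⟨hzb, hz.2⟩
      · exact absurd rfl (h1 hp).2
    · intro z hz
      by_cases hzp : z = p
      · exact .inl (.inr (hzp ▸ mem_ball_self hr))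
      · exact (huv ⟨hz, hzp⟩).elim (fun hzu => .inl (.inl hzu)) fun hzv => .inr ⟨hzv, hzp⟩
    · refine eq_empty_iff_forall_notMem.2 ?_
      rintro z ⟨hzV, hzu | hzb, hzv⟩
      · exact hd' z ⟨hzV, hzv.2⟩ hzu hzv.1
      · exact hd' z ⟨hzV, hzv.2⟩ (hbu ⟨hzb, hzv.2⟩) hzv.1
  intro u v hu hv huv hd
  rcases hb u v hu hv (hbV.trans huv)
    (subset_eq_empty (inter_subset_inter_left _ hbV) hd) with h1 | h1
  · exact .inl (key u v hu hv huv hd h1)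
  · exact .inr (key v u hv hu (union_comm u v ▸ huv) (inter_comm u v ▸ hd) h1)

lemma IsPreconnected.diff_finite (h : 1 < Module.rank ℝ E) {V : Set E} (hV : IsOpen V)
    (hc : IsPreconnected V) {T : Set E} (hT : T.Finite) : IsPreconnected (V \ T) := by
  induction T, hT using Set.Finite.induction_on with
  | empty => simpa
  | @insert a s _ hs ih =>
    rw [← union_singleton, ← sdiff_sdiff]
    exact IsPreconnected.diff_singleton h (hV.sdiff hs.isClosed) ih a

lemma exists_homeomorph_ball [CompleteSpace E] {x y : E} {r : ℝ} (hxy : dist x y < r) :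
    ∃ f : E ≃ₜ E, (∀ z ∉ ball x r, f z = z) ∧ f x = y := by
  have hr : 0 < r := dist_nonneg.trans_lt hxy
  set φ : E → E := fun z => max 0 (1 - dist z x / r) • (y - x) with hφ
  set c : NNReal := ⟨dist x y / r, by positivity⟩ with hc
  have hlip : LipschitzWith c φ := by
    refine LipschitzWith.of_dist_le_mul fun a b => ?_
    have h1 : |max 0 (1 - dist a x / r) - max 0 (1 - dist b x / r)| ≤ dist a b / r := by
      have h2 := abs_max_sub_max_le_max 0 (1 - dist a x / r) 0 (1 - dist b x / r)
      have h3 : 1 - dist a x / r - (1 - dist b x / r) = -((dist a x - dist b x) / r) := by ring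
      rw [sub_self, abs_zero, max_eq_right (a := (0 : ℝ)) (abs_nonneg _), h3, abs_neg, abs_div, abs_of_pos hr] at h2
      exact h2.trans (by gcongr; exact abs_dist_sub_le a b x)
    rw [dist_eq_norm, hφ, ← sub_smul, norm_smul, Real.norm_eq_abs, ← dist_eq_norm y x, dist_comm y x]
    calc _ ≤ dist a b / r * dist x y := by gcongr
      _ = dist x y / r * dist a b := by ring
      _ = (c : ℝ) * dist a b := rfl
  have happ : ApproximatesLinearOn (fun z => z + φ z)
      ((ContinuousLinearEquiv.refl ℝ E : E ≃L[ℝ] E) : E →L[ℝ] E) univ c := by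
    rw [ApproximatesLinearOn.approximatesLinearOn_iff_lipschitzOnWith]
    convert hlip.lipschitzOnWith (s := univ) using 1
    ext z; simp
  have hc1 : c < 1 := by
    rw [← NNReal.coe_lt_coe]; exact (div_lt_one hr).2 hxy
  refine ⟨happ.toHomeomorph _ ?_, fun z hz => ?_, ?_⟩
  · rcases subsingleton_or_nontrivial E with hE | hE
    · exact .inl hE
    · right
      simpa using hc1
  · change z + φ z = z
    have h1 : r ≤ dist z x := by simpa using hz
    have : 1 - dist z x / r ≤ 0 := by
      rw [sub_nonpos, one_le_div hr]; exact h1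
    simp [hφ, max_eq_left this]
  · change x + φ x = y
    simp [hφ]

lemma exists_homeomorph_of_isPreconnected [CompleteSpace E] {V : Set E} (hV : IsOpen V)
    (hc : IsPreconnected V) {x y : E} (hx : x ∈ V) (hy : y ∈ V) :
    ∃ f : E ≃ₜ E, (∀ z ∉ V, f z = z) ∧ f x = y := by
  set R : E → E → Prop := fun a b => ∃ f : E ≃ₜ E, (∀ z ∉ V, f z = z) ∧ f a = b with hR
  have hsymm : ∀ {a b}, R a b → R b a := by
    rintro a b ⟨f, hf, rfl⟩
    exact ⟨f.symm, fun z hz => by rw [Homeomorph.symm_apply_eq, hf z hz], by simp⟩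
  have htrans : ∀ {a b c}, R a b → R b c → R a c := by
    rintro a b c ⟨f, hf, rfl⟩ ⟨g, hg, rfl⟩
    exact ⟨f.trans g, fun z hz => by simp [hf z hz, hg z hz], rfl⟩
  have hloc : ∀ a ∈ V, ∀ᶠ b in 𝓝 a, R a b := by
    intro a ha
    obtain ⟨r, hr, hrV⟩ := Metric.isOpen_iff.1 hV a ha
    filter_upwards [ball_mem_nhds a hr] with b hb
    obtain ⟨f, hf, hfa⟩ := exists_homeomorph_ball (x := a) (y := b) (mem_ball'.1 hb)
    exact ⟨f, fun z hz => hf z fun hz' => hz (hrV hz'), hfa⟩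
  refine hc.induction₂' R (fun a ha => ?_) (fun _ _ _ _ _ _ => htrans) hx hy
  exact eventually_nhdsWithin_of_eventually_nhds ((hloc a ha).mono fun b hb => ⟨hb, hsymm hb⟩)

lemma exists_homeomorph_avoiding [CompleteSpace E] (h : 1 < Module.rank ℝ E) {U B T : Set E}
    (hU : IsOpen U) (hc : IsPreconnected U) (hUb : ¬ IsBounded U) (hB : IsBounded B)
    (hT : T.Finite) (hTU : T ⊆ U) :
    ∃ f : E ≃ₜ E, (∀ z ∉ U, f z = z) ∧ ∀ p ∈ T, f p ∉ B := by
  induction T, hT using Set.Finite.induction_on with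
  | empty => exact ⟨.refl E, fun _ _ => rfl, by simp⟩
  | @insert a s has hs ih =>
    obtain ⟨f, hf, hfB⟩ := ih ((subset_insert a s).trans hTU)
    have hfU : ∀ z ∈ U, f z ∈ U := fun z hz => by
      by_contra hcon
      have := f.injective (hf _ hcon)
      exact hcon (this.symm ▸ hz)
    set V := U \ (f '' s) with hV
    have hVc : IsPreconnected V := IsPreconnected.diff_finite h hU hc (hs.image f)
    have hxV : f a ∈ V := by
      refine ⟨hfU a (hTU (mem_insert a s)), ?_⟩
      rintro ⟨b, hb, hba⟩
      exact has (f.injective hba ▸ hb)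
    obtain ⟨y, hyU, hy⟩ : ∃ y ∈ U, y ∉ B ∪ f '' s := by
      by_contra! hcon
      exact hUb ((hB.union (hs.image f).isBounded).subset hcon)
    obtain ⟨g, hg, hgy⟩ := exists_homeomorph_of_isPreconnected
      (hU.sdiff (hs.image f).isClosed) hVc hxV (y := y) ⟨hyU, fun h' => hy (.inr h')⟩
    refine ⟨f.trans g, fun z hz => ?_, ?_⟩
    · simp [hf z hz, hg z fun h' => hz h'.1]
    · rintro p (rfl | hp)
      · simpa [hgy] using fun h' => hy (.inl h')
      · have : g (f p) = f p := hg _ fun h' => h'.2 ⟨p, hp, rfl⟩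
        simpa [this] using hfB p hp

end Push

section Radial

variable {E : Type*} [NormedAddCommGroup E] [NormedSpace ℝ E]

/-- Pushes the punctured ball of radius `ρ` around `p` radially onto its boundary sphere. -/
noncomputable def radialPush (p : E) (ρ : ℝ) (z : E) : E := p + max 1 (ρ / ‖z - p‖) • (z - p)

lemma radialPush_eq_self {p z : E} {ρ : ℝ} (hρ : 0 < ρ) (h : ρ ≤ dist z p) :
    radialPush p ρ z = z := by
  rw [dist_eq_norm] at h
  have : ρ / ‖z - p‖ ≤ 1 := (div_le_one (hρ.trans_le h)).2 h
  simp [radialPush, max_eq_left this]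

lemma dist_radialPush {p z : E} {ρ : ℝ} (hz : z ≠ p) (h : dist z p ≤ ρ) :
    dist (radialPush p ρ z) p = ρ := by
  rw [dist_eq_norm] at h
  have hpos : 0 < ‖z - p‖ := norm_pos_iff.2 (sub_ne_zero.2 hz)
  have : 1 ≤ ρ / ‖z - p‖ := (one_le_div hpos).2 h
  have hρ : 0 ≤ ρ / ‖z - p‖ := zero_le_one.trans this
  rw [radialPush, max_eq_right this, dist_eq_norm, add_sub_cancel_left, norm_smul,
    Real.norm_of_nonneg hρ, div_mul_cancel₀ _ hpos.ne']

lemma exists_continuous_avoiding_balls {X : Type*} [TopologicalSpace X] {T : Set E}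
    (hT : T.Finite) {ρ : ℝ} (hρ : 0 < ρ) (hsep : ∀ p ∈ T, ∀ q ∈ T, p ≠ q → 2 * ρ ≤ dist p q)
    {F : X → E} (hF : Continuous F) (hFT : ∀ x, F x ∉ T) :
    ∃ G : X → E, Continuous G ∧ (∀ x, ∀ p ∈ T, ρ ≤ dist (G x) p) ∧
      ∀ x, (∀ p ∈ T, ρ ≤ dist (F x) p) → G x = F x := by
  suffices H : ∀ S : Set E, S.Finite → S ⊆ T → ∃ G : X → E, Continuous G ∧ (∀ x, G x ∉ T) ∧
      (∀ x, ∀ p ∈ S, ρ ≤ dist (G x) p) ∧ ∀ x, (∀ p ∈ T, ρ ≤ dist (F x) p) → G x = F x by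
    obtain ⟨G, h1, -, h3, h4⟩ := H T hT subset_rfl
    exact ⟨G, h1, h3, h4⟩
  intro S hS
  induction S, hS using Set.Finite.induction_on with
  | empty => exact fun _ => ⟨F, hF, hFT, by simp, fun _ _ => rfl⟩
  | @insert a s _ _ ih =>
    intro hsT
    have haT : a ∈ T := hsT (mem_insert a s)
    obtain ⟨G, hG, hGT, hGs, hGF⟩ := ih ((subset_insert a s).trans hsT)
    have hne : ∀ x, G x ≠ a := fun x hx => hGT x (hx ▸ haT)
    have hfar : ∀ x, ∀ q ∈ T, q ≠ a →
        (ρ ≤ dist (G x) q → ρ ≤ dist (radialPush a ρ (G x)) q) ∧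
          radialPush a ρ (G x) ≠ q := by
      intro x q hq hqa
      rcases le_total ρ (dist (G x) a) with h | h
      · rw [radialPush_eq_self hρ h]
        exact ⟨id, fun h' => hGT x (h' ▸ hq)⟩
      · have h1 := dist_radialPush (hne x) h
        have h2 := hsep a haT q hq hqa.symm
        have h3 := dist_triangle_left a q (radialPush a ρ (G x))
        refine ⟨fun _ => by linarith, ?_⟩
        rintro h'
        rw [h', dist_self] at h3
        rw [h'] at h1
        linarith
    have hself : ∀ x, ρ ≤ dist (radialPush a ρ (G x)) a := by
      intro x
      rcases le_total ρ (dist (G x) a) with h | h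
      · rwa [radialPush_eq_self hρ h]
      · exact (dist_radialPush (hne x) h).ge
    refine ⟨fun x => radialPush a ρ (G x), ?_, fun x hx => ?_, ?_, fun x hx => ?_⟩
    · unfold radialPush
      refine continuous_const.add (Continuous.smul (continuous_const.max ?_) (hG.sub continuous_const))
      exact continuous_const.div (hG.sub continuous_const).norm
        fun x => norm_ne_zero_iff.2 (sub_ne_zero.2 (hne x))
    · by_cases hq : radialPush a ρ (G x) = a
      · have := hself x
        rw [hq, dist_self] at this
        exact this.not_gt hρ
      · exact (hfar x _ hx hq).2 rfl
    · rintro x p (rfl | hp)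
      · exact hself x
      · by_cases hpa : p = a
        · exact hpa ▸ hself x
        · exact (hfar x p (hsT (.inr hp)) hpa).1 (hGs x p hp)
    · have := hGF x hx
      simp only [this]
      exact radialPush_eq_self hρ (hx a haT)

end Radial

/-- The union of the lines of the square grid of mesh `h`. -/
def gridLines (h : ℝ) : Set (ℝ × ℝ) := {z | (∃ n : ℤ, z.1 = n * h) ∨ ∃ n : ℤ, z.2 = n * h}

lemma exists_continuous_into_gridLines_union {X : Type*} [TopologicalSpace X] {W : Set (ℝ × ℝ)}
    (hW : IsCompact W) (hWc : IsPreconnected Wᶜ) {h : ℝ} (hh : 0 < h) {F : X → ℝ × ℝ}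
    (hF : Continuous F) (hFb : IsBounded (range F)) :
    ∃ G : X → ℝ × ℝ, Continuous G ∧ (∀ x, F x ∈ W → G x = F x) ∧
      ∀ x, G x ∈ gridLines h ∨ ∃ p ∈ W, dist (G x) p ≤ h := by
  have hrank : 1 < Module.rank ℝ (ℝ × ℝ) := by
    simpa using Cardinal.one_lt_two.trans_eq one_add_one_eq_two.symm
  obtain ⟨R₀, hR₀⟩ := hW.isBounded.subset_closedBall 0
  obtain ⟨L, hL⟩ := exists_nat_gt (R₀ / h)
  have hLR : R₀ < L * h := (div_lt_iff₀ hh).1 hL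
  set R : ℝ := L * h with hR
  have hWR : ∀ z ∈ W, |z.1| < R ∧ |z.2| < R := by
    intro z hz
    have h1 : ‖z‖ ≤ R₀ := by simpa using hR₀ hz
    exact ⟨(norm_fst_le z).trans_lt (h1.trans_lt hLR), (norm_snd_le z).trans_lt (h1.trans_lt hLR)⟩
  set c : ℤ × ℤ → ℝ × ℝ := fun n => ((n.1 + 1 / 2) * h, (n.2 + 1 / 2) * h) with hc
  set T : Set (ℝ × ℝ) :=
    c '' {n | n ∈ Ico (-L : ℤ) L ×ˢ Ico (-L : ℤ) L ∧ ∀ p ∈ W, h / 2 < dist p (c n)} with hT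
  have hTfin : T.Finite := Finite.image _
    (((finite_Ico _ _).prod (finite_Ico _ _)).subset fun n hn => hn.1)
  have hTW : T ⊆ Wᶜ := by
    rintro _ ⟨n, hn, rfl⟩ hnW
    have := hn.2 _ hnW
    rw [dist_self] at this
    linarith
  have hsep1 : ∀ m n : ℤ, m ≠ n → h ≤ |(m + 1 / 2 : ℝ) * h - (n + 1 / 2) * h| := by
    intro m n hmn
    have : (1 : ℝ) ≤ |(m : ℝ) - n| := by
      exact_mod_cast Int.one_le_abs (sub_ne_zero.2 hmn)
    rw [← sub_mul, abs_mul, abs_of_pos hh, add_sub_add_right_eq_sub]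
    nlinarith
  have hsep : ∀ p ∈ T, ∀ q ∈ T, p ≠ q → 2 * (h / 2) ≤ dist p q := by
    rintro _ ⟨m, -, rfl⟩ _ ⟨n, -, rfl⟩ hmn
    have : m ≠ n := fun h' => hmn (h' ▸ rfl)
    rw [mul_div_cancel₀ h two_ne_zero, Prod.dist_eq, Real.dist_eq, Real.dist_eq]
    by_cases h1 : m.1 = n.1
    · exact le_max_of_le_right (hsep1 _ _ fun h2 => this (Prod.ext h1 h2))
    · exact le_max_of_le_left (hsep1 _ _ h1)
  have hunb : ¬ IsBounded Wᶜ := by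
    intro hb
    have := hb.union hW.isBounded
    rw [compl_union_self] at this
    exact NormedSpace.unbounded_univ ℝ (ℝ × ℝ) this
  obtain ⟨f, hfW, hfT⟩ := exists_homeomorph_avoiding hrank hW.isClosed.isOpen_compl hWc hunb hFb
    hTfin hTW
  obtain ⟨G, hG, hGT, hGF⟩ := exists_continuous_avoiding_balls hTfin (half_pos hh) hsep
    (f.symm.continuous.comp hF) fun x hx => hfT _ hx ⟨x, by simp⟩
  have hclamp : ∀ t : ℝ, |t| < R → max (-R) (min R t) = t := fun t ht => by
    rw [min_eq_right (abs_lt.1 ht).2.le, max_eq_right (abs_lt.1 ht).1.le]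
  have hclamp' : ∀ t : ℝ, ¬ |t| < R → ∃ n : ℤ, max (-R) (min R t) = n * h := fun t ht => by
    have hR0 : 0 ≤ R := by positivity
    rcases le_abs.1 (not_lt.1 ht) with h1 | h1
    · exact ⟨L, by rw [min_eq_left h1, max_eq_right (by linarith)]; simp [hR]⟩
    · exact ⟨-L, by rw [min_eq_right (by linarith), max_eq_left (by linarith)]; simp [hR]⟩
  refine ⟨fun x => (max (-R) (min R (G x).1), max (-R) (min R (G x).2)), by fun_prop,
    fun x hx => ?_, fun x => ?_⟩
  · have h1 : f.symm (F x) = F x := by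
      rw [Homeomorph.symm_apply_eq, hfW _ fun h' => h' hx]
    have h2 : G x = F x := by
      refine (hGF x ?_).trans h1
      rintro _ ⟨n, hn, rfl⟩
      rw [comp_apply, h1]
      exact (hn.2 _ hx).le
    beta_reduce
    rw [h2, hclamp _ (hWR _ hx).1, hclamp _ (hWR _ hx).2]
  · beta_reduce
    by_cases h1 : |(G x).1| < R
    swap
    · exact .inl (.inl (hclamp' _ h1))
    by_cases h2 : |(G x).2| < R
    swap
    · exact .inl (.inr (hclamp' _ h2))
    rw [hclamp _ h1, hclamp _ h2, Prod.mk.eta]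
    have hfloor : ∀ t : ℝ, |t| < R → ⌊t / h⌋ ∈ Ico (-L : ℤ) L ∧
        |t - (⌊t / h⌋ + 1 / 2) * h| ≤ h / 2 ∧
        (h / 2 ≤ |t - (⌊t / h⌋ + 1 / 2) * h| → ∃ n : ℤ, t = n * h) := by
      intro t ht
      have h3 : ⌊t / h⌋ * h ≤ t := (le_div_iff₀ hh).1 (Int.floor_le _)
      have h4 : t < (⌊t / h⌋ + 1) * h := (div_lt_iff₀ hh).1 (Int.lt_floor_add_one _)
      refine ⟨⟨Int.le_floor.2 ?_, Int.floor_lt.2 ?_⟩, abs_le.2 ⟨by linarith, by linarith⟩, ?_⟩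
      · rw [le_div_iff₀ hh]; push_cast; linarith [(abs_lt.1 ht).1]
      · rw [div_lt_iff₀ hh]; push_cast; exact (abs_lt.1 ht).2
      · intro h5
        rcases le_abs.1 h5 with h6 | h6
        · linarith
        · exact ⟨⌊t / h⌋, by linarith⟩
    obtain ⟨h3, h4, h5⟩ := hfloor _ h1
    obtain ⟨h6, h7, h8⟩ := hfloor _ h2
    set n : ℤ × ℤ := (⌊(G x).1 / h⌋, ⌊(G x).2 / h⌋) with hn
    have hd : dist (G x) (c n) ≤ h / 2 := by
      rw [Prod.dist_eq]
      exact max_le h4 h7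
    by_cases h9 : ∃ p ∈ W, dist p (c n) ≤ h / 2
    · obtain ⟨p, hp, hpn⟩ := h9
      exact .inr ⟨p, hp, by linarith [dist_triangle_right (G x) p (c n)]⟩
    · push Not at h9
      have h10 := hGT x (c n) ⟨n, ⟨⟨h3, h6⟩, h9⟩, rfl⟩
      rw [Prod.dist_eq] at h10
      exact .inl ((le_max_iff.1 h10).imp h5 h8)

section Glue

/-- The closed unit cell of the integer grid with lower left corner `(i, j)`. -/
def gridCell (i j : ℤ) : Set (ℝ × ℝ) := Icc (i : ℝ) (i + 1) ×ˢ Icc (j : ℝ) (j + 1)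

/-- The boundary of `gridCell i j`. -/
def gridCellBoundary (i j : ℤ) : Set (ℝ × ℝ) :=
  {x ∈ gridCell i j | x.1 = i ∨ x.1 = i + 1 ∨ x.2 = j ∨ x.2 = j + 1}

lemma mem_gridCell_floor (x : ℝ × ℝ) : x ∈ gridCell ⌊x.1⌋ ⌊x.2⌋ :=
  ⟨⟨Int.floor_le _, (Int.lt_floor_add_one _).le⟩, ⟨Int.floor_le _, (Int.lt_floor_add_one _).le⟩⟩

lemma locallyFinite_Icc_intCast : LocallyFinite fun i : ℤ => Icc (i : ℝ) (i + 1) := by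
  intro x
  refine ⟨Ioo (x - 1) (x + 1), Ioo_mem_nhds (by linarith) (by linarith),
    (finite_Icc (⌊x⌋ - 3) (⌊x⌋ + 3)).subset ?_⟩
  rintro i ⟨y, ⟨h1, h2⟩, h3, h4⟩
  have h5 := Int.floor_le x
  have h6 := Int.lt_floor_add_one x
  constructor
  · have : ((⌊x⌋ - 3 : ℤ) : ℝ) ≤ i := by push_cast; linarith
    exact_mod_cast this
  · have : (i : ℝ) ≤ ((⌊x⌋ + 3 : ℤ) : ℝ) := by push_cast; linarith
    exact_mod_cast this

lemma exists_continuous_glue_intervals {X Y : Type*} [TopologicalSpace X] [TopologicalSpace Y]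
    {a : X → ℝ} (ha : Continuous a) {f : ℤ → X → Y} (hf : ∀ i, Continuous (f i))
    (hff : ∀ (i : ℤ) x, a x = i + 1 → f i x = f (i + 1) x) :
    ∃ Φ : X → Y, Continuous Φ ∧ ∀ (i : ℤ) x, a x ∈ Icc (i : ℝ) (i + 1) → Φ x = f i x := by
  have key : ∀ (i : ℤ) x, a x ∈ Icc (i : ℝ) (i + 1) → f ⌊a x⌋ x = f i x := by
    intro i x hx
    rcases hx.2.eq_or_lt with h | h
    · have : ⌊a x⌋ = i + 1 := Int.floor_eq_iff.2 (by push_cast; constructor <;> linarith)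
      rw [this, hff i x h]
    · rw [Int.floor_eq_iff.2 ⟨hx.1, h⟩]
  refine ⟨fun x => f ⌊a x⌋ x, ?_, key⟩
  refine (locallyFinite_Icc_intCast.preimage_continuous ha).continuous ?_
    (fun i => isClosed_Icc.preimage ha) fun i => (hf i).continuousOn.congr (key i)
  exact eq_univ_of_forall fun x =>
    mem_iUnion.2 ⟨⌊a x⌋, Int.floor_le _, (Int.lt_floor_add_one _).le⟩

lemma exists_continuous_glue_cells {Y : Type*} [TopologicalSpace Y] {φ : ℤ → ℤ → ℝ × ℝ → Y}
    (hφ : ∀ i j, Continuous (φ i j))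
    (hx : ∀ (i j : ℤ), ∀ y ∈ Icc (j : ℝ) (j + 1), φ i j (i + 1, y) = φ (i + 1) j (i + 1, y))
    (hy : ∀ (i j : ℤ), ∀ x ∈ Icc (i : ℝ) (i + 1), φ i j (x, j + 1) = φ i (j + 1) (x, j + 1)) :
    ∃ Φ : ℝ × ℝ → Y, Continuous Φ ∧ ∀ i j, EqOn Φ (φ i j) (gridCell i j) := by
  set c : ℤ → ℝ → ℝ := fun j y => max j (min (j + 1) y) with hc
  have hcc : ∀ j, Continuous (c j) := fun j => by fun_prop
  have hcI : ∀ (j : ℤ) y, c j y ∈ Icc (j : ℝ) (j + 1) := fun j y =>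
    ⟨le_max_left _ _, max_le (by linarith) (min_le_left _ _)⟩
  have hcs : ∀ (j : ℤ) y, y ∈ Icc (j : ℝ) (j + 1) → c j y = y := fun j y h => by
    simp only [hc, min_eq_right h.2, max_eq_right h.1]
  have row : ∀ j, ∃ ψ : ℝ × ℝ → Y, Continuous ψ ∧
      ∀ (i : ℤ) (x : ℝ × ℝ), x.1 ∈ Icc (i : ℝ) (i + 1) → ψ x = φ i j (x.1, c j x.2) := by
    intro j
    refine exists_continuous_glue_intervals (f := fun i x => φ i j (x.1, c j x.2))
      continuous_fst (fun i => ?_) fun i x h => ?_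
    · exact (hφ i j).comp (continuous_fst.prodMk ((hcc j).comp continuous_snd))
    · simp only [h]
      exact hx i j _ (hcI j _)
  choose ψ hψ hψφ using row
  obtain ⟨Φ, hΦ, hΦψ⟩ := exists_continuous_glue_intervals continuous_snd hψ fun j x h => by
    have h1 := (mem_gridCell_floor x).1
    have h2 : c j x.2 = j + 1 := by rw [h]; exact hcs j _ (by simp)
    have h3 : c (j + 1) x.2 = j + 1 := by rw [h, hcs]; simp
    rw [hψφ j _ x h1, hψφ (j + 1) _ x h1, h2, h3, hy _ _ _ h1]
  refine ⟨Φ, hΦ, fun i j x h => ?_⟩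
  rw [hΦψ j x h.2, hψφ j i x h.1, hcs _ _ h.2]

lemma exists_continuous_replace_cells {Y : Type*} [TopologicalSpace Y] {φ : ℤ → ℤ → ℝ × ℝ → Y}
    {f : ℝ × ℝ → Y} (hφ : ∀ i j, Continuous (φ i j))
    (hφf : ∀ i j, EqOn (φ i j) f (gridCellBoundary i j)) :
    ∃ Φ : ℝ × ℝ → Y, Continuous Φ ∧ ∀ i j, EqOn Φ (φ i j) (gridCell i j) := by
  refine exists_continuous_glue_cells hφ (fun i j y hy => ?_) fun i j x hx => ?_
  · rw [hφf i j ⟨⟨by simp, hy⟩, by simp⟩, hφf (i + 1) j ⟨⟨by simp, hy⟩, by simp⟩]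
  · rw [hφf i j ⟨⟨hx, by simp⟩, by simp⟩, hφf i (j + 1) ⟨⟨hx, by simp⟩, by simp⟩]

end Glue

section Coons

variable {E : Type*} [NormedAddCommGroup E] [NormedSpace ℝ E]

/-- The Coons patch with bottom, top, left and right edges `b`, `t`, `l`, `r`. -/
def coons (b t l r : ℝ → E) (p : ℝ × ℝ) : E :=
  ((1 - p.2) • b p.1 + p.2 • t p.1) + ((1 - p.1) • l p.2 + p.1 • r p.2) -
    ((1 - p.2) • ((1 - p.1) • b 0 + p.1 • b 1) + p.2 • ((1 - p.1) • t 0 + p.1 • t 1))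

lemma continuous_coons {b t l r : ℝ → E} (hb : Continuous b) (ht : Continuous t)
    (hl : Continuous l) (hr : Continuous r) : Continuous (coons b t l r) := by
  unfold coons
  fun_prop

lemma coons_mem_closedBall {b t l r : ℝ → E} {z : E} {ρ : ℝ}
    (hb : ∀ s ∈ Icc (0 : ℝ) 1, b s ∈ closedBall z ρ) (ht : ∀ s ∈ Icc (0 : ℝ) 1, t s ∈ closedBall z ρ)
    (hl : ∀ s ∈ Icc (0 : ℝ) 1, l s ∈ closedBall z ρ) (hr : ∀ s ∈ Icc (0 : ℝ) 1, r s ∈ closedBall z ρ)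
    {p : ℝ × ℝ} (hp : p ∈ Icc (0 : ℝ) 1 ×ˢ Icc (0 : ℝ) 1) :
    coons b t l r p ∈ closedBall z (3 * ρ) := by
  have hconv : ∀ s ∈ Icc (0 : ℝ) 1, ∀ x ∈ closedBall z ρ, ∀ y ∈ closedBall z ρ,
      (1 - s) • x + s • y ∈ closedBall z ρ := fun s hs x hx y hy =>
    convex_closedBall z ρ hx hy (sub_nonneg.2 hs.2) hs.1 (by ring)
  have h0 : (0 : ℝ) ∈ Icc (0 : ℝ) 1 := by simp
  have h1 : (1 : ℝ) ∈ Icc (0 : ℝ) 1 := by simp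
  have hA := hconv _ hp.2 _ (hb _ hp.1) _ (ht _ hp.1)
  have hB := hconv _ hp.1 _ (hl _ hp.2) _ (hr _ hp.2)
  have hC := hconv _ hp.2 _ (hconv _ hp.1 _ (hb 0 h0) _ (hb 1 h1)) _
    (hconv _ hp.1 _ (ht 0 h0) _ (ht 1 h1))
  rw [mem_closedBall, dist_eq_norm] at hA hB hC ⊢
  have e : coons b t l r p - z = ((1 - p.2) • b p.1 + p.2 • t p.1 - z) +
      ((1 - p.1) • l p.2 + p.1 • r p.2 - z) -
      ((1 - p.2) • ((1 - p.1) • b 0 + p.1 • b 1) + p.2 • ((1 - p.1) • t 0 + p.1 • t 1) - z) := by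
    unfold coons
    abel
  rw [e]
  linarith [norm_sub_le ((1 - p.2) • b p.1 + p.2 • t p.1 - z + ((1 - p.1) • l p.2 + p.1 • r p.2 - z))
    ((1 - p.2) • ((1 - p.1) • b 0 + p.1 • b 1) + p.2 • ((1 - p.1) • t 0 + p.1 • t 1) - z),
    norm_add_le ((1 - p.2) • b p.1 + p.2 • t p.1 - z) ((1 - p.1) • l p.2 + p.1 • r p.2 - z)]

/-- A continuous map can be prescribed on the edges of the integer grid, and on the cells in `D`,
while staying close to the boundary values on the other cells. -/
lemma exists_continuous_gridFill {V : ℤ → ℤ → E} {H K : ℤ → ℤ → ℝ → E}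
    (hH : ∀ i j, Continuous (H i j)) (hK : ∀ i j, Continuous (K i j))
    (hH0 : ∀ i j, H i j 0 = V i j) (hH1 : ∀ i j, H i j 1 = V (i + 1) j)
    (hK0 : ∀ i j, K i j 0 = V i j) (hK1 : ∀ i j, K i j 1 = V i (j + 1))
    (D : Set (ℤ × ℤ)) {g : ℝ × ℝ → E} (hg : Continuous g)
    (hgD : ∀ i j, (i, j) ∈ D → ∀ t ∈ Icc (0 : ℝ) 1, g (i + t, j) = H i j t ∧
      g (i + t, j + 1) = H i (j + 1) t ∧ g (i, j + t) = K i j t ∧ g (i + 1, j + t) = K (i + 1) j t) :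
    ∃ Φ : ℝ × ℝ → E, Continuous Φ ∧
      (∀ (i j : ℤ), ∀ t ∈ Icc (0 : ℝ) 1, Φ (i + t, j) = H i j t ∧ Φ (i, j + t) = K i j t) ∧
      (∀ i j, (i, j) ∈ D → EqOn Φ g (gridCell i j)) ∧
      ∀ i j, (i, j) ∉ D → ∀ (z : E) (r : ℝ),
        (∀ t ∈ Icc (0 : ℝ) 1, H i j t ∈ closedBall z r ∧ H i (j + 1) t ∈ closedBall z r ∧
          K i j t ∈ closedBall z r ∧ K (i + 1) j t ∈ closedBall z r) →
        MapsTo Φ (gridCell i j) (closedBall z (3 * r)) := by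
  classical
  set φ : ℤ → ℤ → ℝ × ℝ → E := fun i j => if (i, j) ∈ D then g else
    fun x => coons (H i j) (H i (j + 1)) (K i j) (K (i + 1) j) (x.1 - i, x.2 - j) with hφdef
  have hφD : ∀ i j, (i, j) ∈ D → φ i j = g := fun i j h => if_pos h
  have hφC : ∀ i j, (i, j) ∉ D → φ i j =
    fun x => coons (H i j) (H i (j + 1)) (K i j) (K (i + 1) j) (x.1 - i, x.2 - j) :=
    fun i j h => if_neg h
  have hφ : ∀ i j, Continuous (φ i j) := by
    intro i j
    by_cases h : (i, j) ∈ D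
    · rwa [hφD i j h]
    · rw [hφC i j h]
      exact (continuous_coons (hH _ _) (hH _ _) (hK _ _) (hK _ _)).comp (by fun_prop)
  have hedge : ∀ (i j : ℤ), ∀ t ∈ Icc (0 : ℝ) 1, φ i j (i + t, j) = H i j t ∧
      φ i j (i + t, j + 1) = H i (j + 1) t ∧ φ i j (i, j + t) = K i j t ∧
      φ i j (i + 1, j + t) = K (i + 1) j t := by
    intro i j t ht
    by_cases h : (i, j) ∈ D
    · rw [hφD i j h]
      exact hgD i j h t ht
    · rw [hφC i j h]
      simp only [coons, add_sub_cancel_left, sub_self, hH0, hH1, hK0, hK1, sub_zero, one_smul,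
        zero_smul, add_zero, zero_add]
      refine ⟨?_, ?_, ?_, ?_⟩ <;> first | trivial | module
  obtain ⟨Φ, hΦ, hΦφ⟩ := exists_continuous_glue_cells hφ
    (fun i j y hy => by
      have ht : y - j ∈ Icc (0 : ℝ) 1 := ⟨by linarith [hy.1], by linarith [hy.2]⟩
      have h1 := (hedge i j _ ht).2.2.2
      have h2 := (hedge (i + 1) j _ ht).2.2.1
      rw [add_sub_cancel] at h1 h2
      push_cast at h2
      rw [h1, h2])
    (fun i j x hx => by
      have ht : x - i ∈ Icc (0 : ℝ) 1 := ⟨by linarith [hx.1], by linarith [hx.2]⟩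
      have h1 := (hedge i j _ ht).2.1
      have h2 := (hedge i (j + 1) _ ht).1
      rw [add_sub_cancel] at h1 h2
      push_cast at h2
      rw [h1, h2])
  refine ⟨Φ, hΦ, fun i j t ht => ?_, fun i j h => ?_, fun i j h z r hzr x hx => ?_⟩
  · rw [hΦφ i j ⟨⟨by simp [ht.1], by simp [ht.2]⟩, by simp⟩,
      hΦφ i j ⟨by simp, ⟨by simp [ht.1], by simp [ht.2]⟩⟩]
    exact ⟨(hedge i j t ht).1, (hedge i j t ht).2.2.1⟩
  · rw [← hφD i j h]
    exact hΦφ i j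
  · rw [hΦφ i j hx, hφC i j h]
    refine coons_mem_closedBall (fun t ht => (hzr t ht).1) (fun t ht => (hzr t ht).2.1)
      (fun t ht => (hzr t ht).2.2.1) (fun t ht => (hzr t ht).2.2.2) ?_
    exact ⟨⟨by simpa using hx.1.1, by linarith [hx.1.2]⟩, ⟨by simpa using hx.2.1, by linarith [hx.2.2]⟩⟩

end Coons

section Assembly

lemma UniformlyLocallyJoined.exists_edge {E : Type*} [NormedAddCommGroup E] {W : Set E}
    (hWl : UniformlyLocallyJoined W) (hWp : IsPathConnected W) {ε : ℝ} (hε : 0 < ε) :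
    ∃ δ > 0, ∀ x ∈ W, ∀ y ∈ W, ∃ e : ℝ → E, Continuous e ∧ e 0 = x ∧ e 1 = y ∧
      (∀ t ∈ Icc (0 : ℝ) 1, e t ∈ W) ∧ (dist x y < δ → ∀ t ∈ Icc (0 : ℝ) 1, dist (e t) x ≤ ε) := by
  obtain ⟨δ, hδ, H⟩ := hWl ε hε
  have aux : ∀ (A : Set E) (x y : E), JoinedIn A x y →
      ∃ e : ℝ → E, Continuous e ∧ e 0 = x ∧ e 1 = y ∧ ∀ t ∈ Icc (0 : ℝ) 1, e t ∈ A := by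
    intro A x y h
    refine ⟨h.somePath.extend, h.somePath.continuous_extend, by simp, by simp, fun t ht => ?_⟩
    rw [Path.extend_apply _ ht]
    exact h.somePath_mem _
  refine ⟨δ, hδ, fun x hx y hy => ?_⟩
  by_cases hd : dist x y < δ
  · obtain ⟨e, he, h0, h1, hm⟩ := aux _ x y (H x hx y hy hd)
    exact ⟨e, he, h0, h1, fun t ht => (hm t ht).1, fun _ t ht => (hm t ht).2⟩
  · obtain ⟨e, he, h0, h1, hm⟩ := aux _ x y (hWp.joinedIn x hx y hy)
    exact ⟨e, he, h0, h1, hm, fun h => absurd h hd⟩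

lemma IsCompact.exists_nearest {E : Type*} [PseudoMetricSpace E] {W : Set E} (hW : IsCompact W)
    (hne : W.Nonempty) : ∃ f : E → E, (∀ z, f z ∈ W) ∧ ∀ z, ∀ q ∈ W, dist (f z) z ≤ dist z q := by
  have : ∀ z, ∃ p ∈ W, ∀ q ∈ W, dist p z ≤ dist z q := fun z => by
    obtain ⟨p, hp, h⟩ := hW.exists_infDist_eq_dist hne z
    exact ⟨p, hp, fun q hq => by rw [dist_comm, ← h]; exact infDist_le_dist_of_mem hq⟩
  choose f hf hfq using this
  exact ⟨f, hf, hfq⟩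

/-- The lines of a fine grid can be mapped continuously into `W` while moving points near `W` only
a little. -/
lemma exists_gridLines_mapsTo {W : Set (ℝ × ℝ)} (hW : IsCompact W) (hWp : IsPathConnected W)
    (hWl : UniformlyLocallyJoined W) {ε : ℝ} (hε : 0 < ε) :
    ∃ h₀ > 0, ∀ h, 0 < h → h ≤ h₀ → ∃ M : ℝ × ℝ → ℝ × ℝ, Continuous M ∧
      MapsTo M (gridLines h) W ∧
      ∀ z ∈ gridLines h, ∀ p ∈ W, dist z p ≤ 2 * h → dist (M z) z ≤ ε := by
  obtain ⟨near, hnear, hnear'⟩ := hW.exists_nearest hWp.nonempty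
  obtain ⟨δ, hδ, H⟩ := hWl.exists_edge hWp (half_pos hε)
  refine ⟨min (ε / 10) (δ / 10), by positivity, fun h hh hle => ?_⟩
  have hhε : h ≤ ε / 10 := hle.trans (min_le_left _ _)
  have hhδ : h ≤ δ / 10 := hle.trans (min_le_right _ _)
  choose! e he he0 he1 heW hed using H
  set P : ℤ → ℤ → ℝ × ℝ := fun i j => (i * h, j * h) with hP
  set V : ℤ → ℤ → ℝ × ℝ := fun i j => near (P i j) with hV
  have hVW : ∀ i j, V i j ∈ W := fun i j => hnear _
  obtain ⟨Φ, hΦ, hΦe, -, -⟩ := exists_continuous_gridFill (V := V)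
    (H := fun i j => e (V i j) (V (i + 1) j)) (K := fun i j => e (V i j) (V i (j + 1)))
    (fun i j => he _ (hVW _ _) _ (hVW _ _)) (fun i j => he _ (hVW _ _) _ (hVW _ _))
    (fun i j => he0 _ (hVW _ _) _ (hVW _ _)) (fun i j => he1 _ (hVW _ _) _ (hVW _ _))
    (fun i j => he0 _ (hVW _ _) _ (hVW _ _)) (fun i j => he1 _ (hVW _ _) _ (hVW _ _))
    ∅ continuous_const (g := fun _ => 0) (by simp)
  have key : ∀ z ∈ gridLines h, ∃ i j i' j' : ℤ, dist z (P i j) ≤ h ∧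
      dist (P i j) (P i' j') ≤ h ∧
      ∃ t ∈ Icc (0 : ℝ) 1, Φ (z.1 / h, z.2 / h) = e (V i j) (V i' j') t := by
    have hfl : ∀ s : ℝ, s / h - ⌊s / h⌋ ∈ Icc (0 : ℝ) 1 ∧ |s - ⌊s / h⌋ * h| ≤ h := by
      intro s
      have h1 := Int.floor_le (s / h)
      have h2 := (Int.lt_floor_add_one (s / h)).le
      refine ⟨⟨by linarith, by linarith⟩, ?_⟩
      rw [le_div_iff₀ hh] at h1
      rw [div_le_iff₀ hh] at h2
      exact abs_le.2 ⟨by linarith, by linarith⟩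
    have hstep : ∀ i : ℤ, |(i : ℝ) * h - ((i + 1 : ℤ) : ℝ) * h| ≤ h := by
      intro i
      push_cast
      rw [abs_le]
      constructor <;> linarith
    rintro ⟨x, y⟩ (⟨n, hn⟩ | ⟨n, hn⟩) <;> simp only at hn <;> subst hn
    · refine ⟨n, ⌊y / h⌋, n, ⌊y / h⌋ + 1, ?_, ?_, _, (hfl y).1, ?_⟩
      · simp only [hP, Prod.dist_eq, Real.dist_eq, sub_self, abs_zero]
        exact max_le hh.le (hfl y).2
      · simp only [hP, Prod.dist_eq, Real.dist_eq, sub_self, abs_zero]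
        exact max_le hh.le (hstep _)
      · have := (hΦe n ⌊y / h⌋ _ (hfl y).1).2
        rwa [add_sub_cancel, ← mul_div_cancel_right₀ (n : ℝ) hh.ne'] at this
    · refine ⟨⌊x / h⌋, n, ⌊x / h⌋ + 1, n, ?_, ?_, _, (hfl x).1, ?_⟩
      · simp only [hP, Prod.dist_eq, Real.dist_eq, sub_self, abs_zero]
        exact max_le (hfl x).2 hh.le
      · simp only [hP, Prod.dist_eq, Real.dist_eq, sub_self, abs_zero]
        exact max_le (hstep _) hh.le
      · have := (hΦe ⌊x / h⌋ n _ (hfl x).1).1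
        rwa [add_sub_cancel, ← mul_div_cancel_right₀ (n : ℝ) hh.ne'] at this
  refine ⟨fun z => Φ (z.1 / h, z.2 / h), hΦ.comp (by fun_prop), fun z hz => ?_,
    fun z hz p hp hzp => ?_⟩
  · obtain ⟨i, j, i', j', -, -, t, ht, h1⟩ := key z hz
    simp only [h1]
    exact heW _ (hVW _ _) _ (hVW _ _) t ht
  · obtain ⟨i, j, i', j', h2, h3, t, ht, h1⟩ := key z hz
    simp only [h1]
    have h4 : dist (V i j) (P i j) ≤ 3 * h := by
      linarith [hnear' (P i j) p hp, dist_triangle_left (P i j) p z]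
    have h5 : dist (V i' j') (P i' j') ≤ 4 * h := by
      linarith [hnear' (P i' j') p hp, dist_triangle_left (P i j) p z,
        dist_triangle_left (P i' j') p (P i j)]
    have h6 : dist (V i j) (V i' j') < δ := by
      linarith [dist_triangle4 (V i j) (P i j) (P i' j') (V i' j'), dist_comm (P i' j') (V i' j')]
    have h7 := hed _ (hVW i j) _ (hVW i' j') h6 t ht
    linarith [dist_triangle4 (e (V i j) (V i' j') t) (V i j) (P i j) z, dist_comm z (P i j)]

/-- A curve consisting of points on grid lines or near `W` can be replaced by a curve in `W`, with
end points depending only on those of the original curve. -/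
lemma exists_edge_filling {W : Set (ℝ × ℝ)} (hW : IsCompact W) (hWp : IsPathConnected W)
    (hWl : UniformlyLocallyJoined W) {ε : ℝ} (hε : 0 < ε) :
    ∃ h, 0 < h ∧ h ≤ ε ∧ ∃ M V : ℝ × ℝ → ℝ × ℝ, Continuous M ∧ MapsTo M (gridLines h) W ∧
      ∀ c : ℝ → ℝ × ℝ, Continuous c →
        (∀ t ∈ Icc (0 : ℝ) 1, c t ∈ gridLines h ∨ ∃ p ∈ W, dist (c t) p ≤ h) →
        (∀ s ∈ Icc (0 : ℝ) 1, ∀ t ∈ Icc (0 : ℝ) 1, dist (c s) (c t) ≤ h) →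
        ∃ e : ℝ → ℝ × ℝ, Continuous e ∧ e 0 = V (c 0) ∧ e 1 = V (c 1) ∧ MapsTo e (Icc 0 1) W ∧
          (MapsTo c (Icc 0 1) W → EqOn e c (Icc 0 1)) ∧
          (MapsTo c (Icc 0 1) (gridLines h \ W) → EqOn e (M ∘ c) (Icc 0 1)) ∧
          ∀ t ∈ Icc (0 : ℝ) 1, (∃ p ∈ W, dist (c t) p ≤ 2 * h) → dist (e t) (c t) ≤ ε := by
  classical
  obtain ⟨near, hnear, hnear'⟩ := hW.exists_nearest hWp.nonempty
  obtain ⟨δ, hδ, hedge⟩ := hWl.exists_edge hWp (show 0 < ε / 4 by positivity)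
  obtain ⟨h₀, hh₀, hM⟩ := exists_gridLines_mapsTo hW hWp hWl
    (show 0 < min (ε / 8) (δ / 8) by positivity)
  set h := min h₀ (min (ε / 16) (δ / 16)) with hh
  have hpos : 0 < h := by positivity
  have hhε : h ≤ ε / 16 := (min_le_right _ _).trans (min_le_left _ _)
  have hhδ : h ≤ δ / 16 := (min_le_right _ _).trans (min_le_right _ _)
  obtain ⟨M, hMc, hMW, hMd⟩ := hM h hpos (min_le_left _ _)
  set V : ℝ × ℝ → ℝ × ℝ := fun z => if z ∈ W then z else if z ∈ gridLines h then M z else near z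
    with hVdef
  have hVW : ∀ z, V z ∈ W := fun z => by
    simp only [hVdef]
    split_ifs with h1 h2
    exacts [h1, hMW h2, hnear z]
  have hVd : ∀ z, (∃ p ∈ W, dist z p ≤ 2 * h) → dist (V z) z ≤ ε / 4 ∧ dist (V z) z ≤ δ / 4 := by
    rintro z ⟨p, hp, hzp⟩
    simp only [hVdef]
    split_ifs with h1 h2
    · rw [dist_self]
      constructor <;> positivity
    · have := hMd z h2 p hp hzp
      exact ⟨by linarith [this.trans (min_le_left _ _)], by linarith [this.trans (min_le_right _ _)]⟩
    · have := hnear' z p hp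
      constructor <;> linarith
  have h0 : (0 : ℝ) ∈ Icc (0 : ℝ) 1 := by simp
  have h1 : (1 : ℝ) ∈ Icc (0 : ℝ) 1 := by simp
  refine ⟨h, hpos, by linarith, M, V, hMc, hMW, fun c hc hcn hcd => ?_⟩
  by_cases hA : MapsTo c (Icc 0 1) W
  · exact ⟨c, hc, (if_pos (hA h0)).symm, (if_pos (hA h1)).symm, hA, fun _ => eqOn_refl _ _,
      fun hB => absurd (hA h0) (hB h0).2, fun t _ _ => by simpa using hε.le⟩
  by_cases hB : MapsTo c (Icc 0 1) (gridLines h \ W)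
  · have hBV : ∀ t ∈ Icc (0 : ℝ) 1, M (c t) = V (c t) := fun t ht => by
      simp only [hVdef, if_neg (hB ht).2, if_pos (hB ht).1]
    refine ⟨M ∘ c, hMc.comp hc, hBV 0 h0, hBV 1 h1, fun t ht => hMW (hB ht).1,
      fun h => absurd h hA, fun _ => eqOn_refl _ _, ?_⟩
    rintro t ht ⟨p, hp, htp⟩
    rw [comp_apply]
    linarith [(hMd _ (hB ht).1 p hp htp).trans (min_le_left _ _)]
  obtain ⟨t₀, ht₀, p, hp, hd⟩ : ∃ t ∈ Icc (0 : ℝ) 1, ∃ p ∈ W, dist (c t) p ≤ h := by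
    by_contra! H
    refine hB fun t ht => ⟨(hcn t ht).resolve_right ?_, fun hW => ?_⟩
    · rintro ⟨p, hp, h2⟩
      exact (H t ht p hp).not_ge h2
    · have := H t ht _ hW
      rw [dist_self] at this
      linarith
  have hnr : ∀ t ∈ Icc (0 : ℝ) 1, ∃ p ∈ W, dist (c t) p ≤ 2 * h := fun t ht =>
    ⟨p, hp, by linarith [dist_triangle (c t) (c t₀) p, hcd t ht t₀ ht₀]⟩
  obtain ⟨e, he, he0, he1, heW, hed⟩ := hedge _ (hVW (c 0)) _ (hVW (c 1))
  refine ⟨e, he, he0, he1, heW, fun h => absurd h hA, fun h => absurd h hB, fun t ht _ => ?_⟩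
  have h2 := hVd _ (hnr 0 h0)
  have h3 := hVd _ (hnr 1 h1)
  have h4 := hed (by
    linarith [dist_triangle4 (V (c 0)) (c 0) (c 1) (V (c 1)), dist_comm (c 1) (V (c 1)),
      hcd 0 h0 1 h1]) t ht
  linarith [dist_triangle4 (e t) (V (c 0)) (c 0) (c t), hcd 0 h0 t ht]

/-- A cell is good if it is mapped to `W`, or if its boundary is and its image is small. -/
def CellGood (W : Set (ℝ × ℝ)) (ε : ℝ) (f : ℝ × ℝ → ℝ × ℝ) (i j : ℤ) : Prop :=
  MapsTo f (gridCell i j) W ∨ MapsTo f (gridCellBoundary i j) W ∧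
    ∀ x ∈ gridCell i j, ∀ y ∈ gridCell i j, dist (f x) (f y) ≤ ε

/-- The retraction of the plane to the unit square. -/
def clampSquare (x : ℝ × ℝ) : ℝ × ℝ := (max 0 (min 1 x.1), max 0 (min 1 x.2))

lemma lipschitzWith_clampSquare : LipschitzWith 1 clampSquare := by
  have h1 : LipschitzWith 1 fun x : ℝ × ℝ => max 0 (min 1 x.1) :=
    (LipschitzWith.prod_fst.const_min 1).const_max 0
  have h2 : LipschitzWith 1 fun x : ℝ × ℝ => max 0 (min 1 x.2) :=
    (LipschitzWith.prod_snd.const_min 1).const_max 0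
  rw [← max_self (1 : NNReal)]
  exact h1.prodMk h2

lemma clampSquare_mem (x : ℝ × ℝ) : clampSquare x ∈ gridCell 0 0 := by
  simp [clampSquare, gridCell]

lemma clampSquare_eq_self {x : ℝ × ℝ} (hx : x ∈ gridCell 0 0) : clampSquare x = x := by
  simp only [gridCell, Int.cast_zero, zero_add] at hx
  simp only [clampSquare, min_eq_right hx.1.2, max_eq_right hx.1.1, min_eq_right hx.2.2,
    max_eq_right hx.2.1]

lemma isCompact_gridCell (i j : ℤ) : IsCompact (gridCell i j) := isCompact_Icc.prod isCompact_Icc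

lemma dist_le_one_of_mem_gridCell {i j : ℤ} {x y : ℝ × ℝ} (hx : x ∈ gridCell i j)
    (hy : y ∈ gridCell i j) : dist x y ≤ 1 := by
  rw [Prod.dist_eq]
  exact max_le ((Real.dist_le_of_mem_Icc hx.1 hy.1).trans_eq (by ring))
    ((Real.dist_le_of_mem_Icc hx.2 hy.2).trans_eq (by ring))

end Assembly

section Subdivide

lemma exists_cellGood {W : Set (ℝ × ℝ)} (hW : IsCompact W) (hWc : IsPreconnected Wᶜ)
    (hWp : IsPathConnected W) (hWl : UniformlyLocallyJoined W) {u : ℝ × ℝ → ℝ × ℝ}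
    (hu : Continuous u) (huW : MapsTo u (gridCellBoundary 0 0) W) {ε : ℝ} (hε : 0 < ε) :
    ∃ N₀ : ℕ, ∀ N : ℕ, N₀ ≤ N → 0 < N → ∃ v : ℝ × ℝ → ℝ × ℝ, Continuous v ∧
      (∀ i j, CellGood W ε v i j) ∧ ∀ x ∈ gridCellBoundary 0 0, v ((N : ℝ) • x) = u x := by
  obtain ⟨h, hh, hhε, M, V, hM, hMW, hedge⟩ :=
    exists_edge_filling hW hWp hWl (show 0 < ε / 12 by positivity)
  have hκ := lipschitzWith_clampSquare
  obtain ⟨G, hG, hGW, hGn⟩ := exists_continuous_into_gridLines_union hW hWc hh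
    (hu.comp hκ.continuous) (((isCompact_gridCell 0 0).image hu).isBounded.subset (by
      rintro _ ⟨x, rfl⟩
      exact mem_image_of_mem u (clampSquare_mem x)))
  obtain ⟨η, hη, hGη⟩ := Metric.uniformContinuousOn_iff_le.1
    ((isCompact_gridCell 0 0).uniformContinuousOn_of_continuous hG.continuousOn) h hh
  obtain ⟨N₀, hN₀⟩ := exists_nat_gt (1 / η)
  refine ⟨N₀, fun N hN hNpos => ?_⟩
  have hN' : (0 : ℝ) < N := by exact_mod_cast hNpos
  have hNη : 1 / (N : ℝ) ≤ η := by
    rw [div_le_iff₀ hN', mul_comm, ← div_le_iff₀ hη]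
    exact hN₀.le.trans (by exact_mod_cast hN)
  set w : ℝ × ℝ → ℝ × ℝ := fun x => G (clampSquare ((1 / (N : ℝ)) • x)) with hw
  have hwc : Continuous w := hG.comp (hκ.continuous.comp (by fun_prop))
  have hwn : ∀ x, w x ∈ gridLines h ∨ ∃ p ∈ W, dist (w x) p ≤ h := fun x => hGn _
  have hwd : ∀ x y, dist x y ≤ 1 → dist (w x) (w y) ≤ h := fun x y hxy => by
    refine hGη _ (clampSquare_mem _) _ (clampSquare_mem _) ?_
    have h1 := hκ.dist_le_mul ((1 / (N : ℝ)) • x) ((1 / (N : ℝ)) • y)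
    rw [dist_smul₀, Real.norm_of_nonneg (by positivity), NNReal.coe_one, one_mul] at h1
    nlinarith [show 0 < 1 / (N : ℝ) by positivity]
  have hbd : ∀ x, clampSquare x ∈ gridCellBoundary 0 0 → G (clampSquare x) = u (clampSquare x) := by
    intro x hx
    have h1 : u (clampSquare (clampSquare x)) = u (clampSquare x) := by
      rw [clampSquare_eq_self (clampSquare_mem x)]
    rw [hGW _ (by rw [comp_apply, h1]; exact huW hx), comp_apply, h1]
  have hIcc : ∀ s ∈ Icc (0 : ℝ) 1, ∀ t ∈ Icc (0 : ℝ) 1, |s - t| ≤ 1 := fun s hs t ht =>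
    abs_le.2 ⟨by linarith [hs.1, ht.2], by linarith [hs.2, ht.1]⟩
  choose H hHc hH0 hH1 hHW hHw hHM hHd using fun i j : ℤ =>
    hedge (fun t => w (i + t, j)) (by fun_prop) (fun t _ => hwn _) fun s hs t ht => hwd _ _ (by
      simpa [Prod.dist_eq, Real.dist_eq] using hIcc s hs t ht)
  choose K hKc hK0 hK1 hKW hKw hKM hKd using fun i j : ℤ =>
    hedge (fun t => w (i, j + t)) (by fun_prop) (fun t _ => hwn _) fun s hs t ht => hwd _ _ (by
      simpa [Prod.dist_eq, Real.dist_eq] using hIcc s hs t ht)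
  have hmem : ∀ (i j : ℤ), ∀ t ∈ Icc (0 : ℝ) 1, ((i + t, j) : ℝ × ℝ) ∈ gridCell i j ∧
      ((i + t, j + 1) : ℝ × ℝ) ∈ gridCell i j ∧ ((i, j + t) : ℝ × ℝ) ∈ gridCell i j ∧
      ((i + 1, j + t) : ℝ × ℝ) ∈ gridCell i j := by
    intro i j t ht
    simp [gridCell, ht.1, ht.2]
  obtain ⟨Φ, hΦ, hΦe, hΦD, hΦC⟩ := exists_continuous_gridFill
    (V := fun i j => V (w (i, j))) hHc hKc
    (fun i j => by simp [hH0]) (fun i j => by simp [hH1]) (fun i j => by simp [hK0])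
    (fun i j => by simp [hK1]) {n | MapsTo w (gridCell n.1 n.2) (gridLines h \ W)}
    (hM.comp hwc) (fun i j hD t ht => by
      have hm := hmem i j
      refine ⟨(hHM i j (fun s hs => hD (hm s hs).1) ht).symm, ?_,
        (hKM i j (fun s hs => hD (hm s hs).2.2.1) ht).symm, ?_⟩
      · have := hHM i (j + 1) (fun s hs => hD (by simpa using (hm s hs).2.1)) ht
        simpa using this.symm
      · have := hKM (i + 1) j (fun s hs => hD (by simpa using (hm s hs).2.2.2)) ht
        simpa using this.symm)
  have hparam : ∀ (i j : ℤ), ∀ x ∈ gridCell i j,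
      x.1 - i ∈ Icc (0 : ℝ) 1 ∧ x.2 - j ∈ Icc (0 : ℝ) 1 := fun i j x hx =>
    ⟨⟨by linarith [hx.1.1], by linarith [hx.1.2]⟩, ⟨by linarith [hx.2.1], by linarith [hx.2.2]⟩⟩
  refine ⟨Φ, hΦ, fun i j => ?_, ?_⟩
  · by_cases hD : MapsTo w (gridCell i j) (gridLines h \ W)
    · left
      intro x hx
      rw [hΦD i j hD hx]
      exact hMW (hD hx).1
    right
    constructor
    · rintro ⟨x, y⟩ ⟨hxy, hb⟩
      obtain ⟨hx, hy⟩ := hparam i j _ hxy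
      simp only at hb hx hy
      rcases hb with rfl | rfl | rfl | rfl
      · have := (hΦe i j _ hy).2
        rw [add_sub_cancel] at this
        exact this ▸ hKW i j hy
      · have := (hΦe (i + 1) j _ hy).2
        rw [add_sub_cancel] at this
        push_cast at this
        exact this ▸ hKW (i + 1) j hy
      · have := (hΦe i j _ hx).1
        rw [add_sub_cancel] at this
        exact this ▸ hHW i j hx
      · have := (hΦe i (j + 1) _ hx).1
        rw [add_sub_cancel] at this
        push_cast at this
        exact this ▸ hHW i (j + 1) hx
    · obtain ⟨x₀, hx₀, p, hp, hd⟩ : ∃ x ∈ gridCell i j, ∃ p ∈ W, dist (w x) p ≤ h := by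
        by_contra! H
        refine hD fun t ht => ⟨(hwn t).resolve_right ?_, fun hW => ?_⟩
        · rintro ⟨p, hp, h2⟩
          exact (H t ht p hp).not_ge h2
        · have := H t ht _ hW
          rw [dist_self] at this
          linarith
      have hnear : ∀ x ∈ gridCell i j, dist (w x) (w x₀) ≤ h ∧ ∃ p ∈ W, dist (w x) p ≤ 2 * h := by
        intro x hx
        have := hwd x x₀ (dist_le_one_of_mem_gridCell hx hx₀)
        exact ⟨this, p, hp, by linarith [dist_triangle (w x) (w x₀) p]⟩
      have hball : ∀ (y : ℝ × ℝ) x, x ∈ gridCell i j → dist y (w x) ≤ ε / 12 →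
          y ∈ closedBall (w x₀) (ε / 6) := by
        intro y x hx hy
        rw [mem_closedBall]
        linarith [dist_triangle y (w x) (w x₀), (hnear x hx).1]
      have hcell := hΦC i j hD (w x₀) (ε / 6) fun t ht => by
        obtain ⟨h1, h2, h3, h4⟩ := hmem i j t ht
        refine ⟨hball _ _ h1 (hHd i j t ht (hnear _ h1).2), hball _ _ h2 ?_,
          hball _ _ h3 (hKd i j t ht (hnear _ h3).2), hball _ _ h4 ?_⟩
        · have := hHd i (j + 1) t ht
          push_cast at this
          exact this (hnear _ h2).2
        · have := hKd (i + 1) j t ht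
          push_cast at this
          exact this (hnear _ h4).2
      intro x hx y hy
      have h1 := mem_closedBall.1 (hcell hx)
      have h2 := mem_closedBall.1 (hcell hy)
      linarith [dist_triangle_right (Φ x) (Φ y) (w x₀)]
  · have hvert : ∀ a : ℤ, (∀ s, w (a, s) ∈ W) → ∀ s, Φ (a, s) = w (a, s) := by
      intro a ha s
      have h1 := (hparam _ _ _ (mem_gridCell_floor (0, s))).2
      simp only at h1
      have h2 := (hΦe a ⌊s⌋ _ h1).2
      have h3 := hKw a ⌊s⌋ (fun t _ => ha _) h1
      simp only [add_sub_cancel] at h2 h3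
      rw [h2, h3]
    have hhor : ∀ a : ℤ, (∀ s, w (s, a) ∈ W) → ∀ s, Φ (s, a) = w (s, a) := by
      intro a ha s
      have h1 := (hparam _ _ _ (mem_gridCell_floor (s, 0))).1
      simp only at h1
      have h2 := (hΦe ⌊s⌋ a _ h1).1
      have h3 := hHw ⌊s⌋ a (fun t _ => ha _) h1
      simp only [add_sub_cancel] at h2 h3
      rw [h2, h3]
    have hwW : ∀ y, clampSquare ((1 / (N : ℝ)) • y) ∈ gridCellBoundary 0 0 → w y ∈ W := by
      intro y hy
      simp only [hw, hbd _ hy]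
      exact huW hy
    intro x hx
    have hwx : w ((N : ℝ) • x) = u x := by
      have h1 : clampSquare ((1 / (N : ℝ)) • (N : ℝ) • x) = x := by
        rw [smul_smul, one_div_mul_cancel hN'.ne', one_smul, clampSquare_eq_self hx.1]
      have h2 := hbd ((1 / (N : ℝ)) • (N : ℝ) • x) (by rwa [h1])
      rw [h1] at h2
      simp only [hw, h1, h2]
    rw [← hwx]
    obtain ⟨x, y⟩ := x
    obtain ⟨-, hb⟩ := hx
    simp only [Int.cast_zero, zero_add] at hb
    rw [Prod.smul_mk, smul_eq_mul, smul_eq_mul]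
    rcases hb with rfl | rfl | rfl | rfl
    · rw [mul_zero]
      exact_mod_cast hvert 0 (fun s => hwW _ ⟨clampSquare_mem _, by simp [clampSquare]⟩) _
    · rw [mul_one]
      exact_mod_cast hvert N
        (fun s => hwW _ ⟨clampSquare_mem _, by simp [clampSquare, hN'.ne']⟩) _
    · rw [mul_zero]
      exact_mod_cast hhor 0 (fun s => hwW _ ⟨clampSquare_mem _, by simp [clampSquare]⟩) _
    · rw [mul_one]
      exact_mod_cast hhor N
        (fun s => hwW _ ⟨clampSquare_mem _, by simp [clampSquare, hN'.ne']⟩) _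

end Subdivide

section Refine

lemma exists_image_Icc_eq_gridCellBoundary :
    ∃ β : ℝ → ℝ × ℝ, Continuous β ∧ β '' Icc 0 1 = gridCellBoundary 0 0 := by
  refine ⟨fun t => (max 0 (min 1 (min (4 * t) (3 - 4 * t))),
    max 0 (min 1 (min (4 * t - 1) (4 - 4 * t)))), by fun_prop, Subset.antisymm ?_ ?_⟩
  · rintro _ ⟨t, ht, rfl⟩
    refine ⟨by simp [gridCell], ?_⟩
    simp only [Int.cast_zero, zero_add]
    rcases le_total (4 * t) 1 with h | h
    · right; right; left
      rw [min_eq_left (by linarith : 4 * t - 1 ≤ 4 - 4 * t), min_eq_right (by linarith),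
        max_eq_left (by linarith)]
    rcases le_total (4 * t) 2 with h' | h'
    · right; left
      rw [min_eq_left (le_min h (by linarith)), max_eq_right zero_le_one]
    rcases le_total (4 * t) 3 with h' | h'
    · right; right; right
      rw [min_eq_left (le_min (by linarith) (by linarith)), max_eq_right zero_le_one]
    · left
      rw [min_eq_right (by linarith : 3 - 4 * t ≤ 4 * t), min_eq_right (by linarith),
        max_eq_left (by linarith)]
  · rintro ⟨x, y⟩ ⟨⟨⟨hx0, hx1⟩, hy0, hy1⟩, hb⟩
    simp only [Int.cast_zero, zero_add] at hx0 hx1 hy0 hy1 hb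
    rcases hb with rfl | rfl | rfl | rfl
    · refine ⟨1 - y / 4, ⟨by linarith, by linarith⟩, Prod.ext ?_ ?_⟩ <;> dsimp only
      · rw [min_eq_right (by linarith : 3 - 4 * (1 - y / 4) ≤ 4 * (1 - y / 4)),
          min_eq_right (by linarith), max_eq_left (by linarith)]
      · rw [min_eq_right (by linarith : 4 - 4 * (1 - y / 4) ≤ 4 * (1 - y / 4) - 1),
          min_eq_right (by linarith), max_eq_right (by linarith)]
        ring
    · refine ⟨(1 + y) / 4, ⟨by linarith, by linarith⟩, Prod.ext ?_ ?_⟩ <;> dsimp only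
      · rw [min_eq_left (le_min (by linarith) (by linarith)), max_eq_right zero_le_one]
      · rw [min_eq_left (by linarith : 4 * ((1 + y) / 4) - 1 ≤ 4 - 4 * ((1 + y) / 4)),
          min_eq_right (by linarith), max_eq_right (by linarith)]
        ring
    · refine ⟨x / 4, ⟨by linarith, by linarith⟩, Prod.ext ?_ ?_⟩ <;> dsimp only
      · rw [min_eq_left (by linarith : 4 * (x / 4) ≤ 3 - 4 * (x / 4)),
          min_eq_right (by linarith), max_eq_right (by linarith)]
        ring
      · rw [min_eq_left (by linarith : 4 * (x / 4) - 1 ≤ 4 - 4 * (x / 4)),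
          min_eq_right (by linarith), max_eq_left (by linarith)]
    · refine ⟨(3 - x) / 4, ⟨by linarith, by linarith⟩, Prod.ext ?_ ?_⟩ <;> dsimp only
      · rw [min_eq_right (by linarith : 3 - 4 * ((3 - x) / 4) ≤ 4 * ((3 - x) / 4)),
          min_eq_right (by linarith), max_eq_right (by linarith)]
        ring
      · rw [min_eq_left (le_min (by linarith) (by linarith)), max_eq_right zero_le_one]

lemma exists_cellGood_filled {u : ℝ × ℝ → ℝ × ℝ} (hu : Continuous u) {ε : ℝ} (hε : 0 < ε) :
    ∃ N₀ : ℕ, ∀ N : ℕ, N₀ ≤ N → 0 < N → ∃ v : ℝ × ℝ → ℝ × ℝ, Continuous v ∧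
      (∀ i j, CellGood (filled (u '' gridCellBoundary 0 0)) ε v i j) ∧
      ∀ x ∈ gridCellBoundary 0 0, v ((N : ℝ) • x) = u x := by
  obtain ⟨β, hβ, hβi⟩ := exists_image_Icc_eq_gridCellBoundary
  have hK : u '' gridCellBoundary 0 0 = (u ∘ β) '' Icc 0 1 := by rw [image_comp, hβi]
  rw [hK]
  have hc := hu.comp hβ
  have hKc : IsCompact ((u ∘ β) '' Icc (0 : ℝ) 1) := isCompact_Icc.image hc
  have hKp : IsPathConnected ((u ∘ β) '' Icc (0 : ℝ) 1) :=
    ((convex_Icc (0 : ℝ) 1).isPathConnected ⟨0, by simp⟩).image hc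
  exact exists_cellGood
    (Metric.isCompact_of_isClosed_isBounded (isClosed_filled hKc.isClosed)
      (isBounded_filled hKc.isBounded))
    (isPreconnected_compl_filled (by
      simpa using Cardinal.one_lt_two.trans_eq one_add_one_eq_two.symm) hKc.isBounded)
    (isPathConnected_filled hKc.isClosed hKp)
    (uniformlyLocallyJoined_filled hKc.isClosed (uniformlyLocallyJoined_image hc.continuousOn)) hu
    (fun x hx => subset_filled _ (hK ▸ mem_image_of_mem u hx)) hε

/-- The vertex of the integer grid with the given coordinates. -/
def gridPoint (i j : ℤ) : ℝ × ℝ := (i, j)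

lemma sub_mem_gridCell {x : ℝ × ℝ} {i j k l : ℤ} :
    x - gridPoint k l ∈ gridCell i j ↔ x ∈ gridCell (i + k) (j + l) := by
  simp only [gridPoint, gridCell, mem_prod, mem_Icc, Prod.fst_sub, Prod.snd_sub, Int.cast_add]
  constructor <;> rintro ⟨⟨h1, h2⟩, h3, h4⟩ <;> refine ⟨⟨?_, ?_⟩, ?_, ?_⟩ <;> linarith

lemma sub_mem_gridCellBoundary {x : ℝ × ℝ} {i j k l : ℤ} :
    x - gridPoint k l ∈ gridCellBoundary i j ↔ x ∈ gridCellBoundary (i + k) (j + l) := by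
  refine and_congr sub_mem_gridCell ?_
  simp only [gridPoint, Prod.fst_sub, Prod.snd_sub, Int.cast_add, sub_eq_iff_eq_add]
  rw [add_right_comm, add_right_comm (j : ℝ)]

lemma mem_gridCellBoundary_floor {x : ℝ × ℝ} (hx : x ∈ gridLines 1) :
    x ∈ gridCellBoundary ⌊x.1⌋ ⌊x.2⌋ := by
  refine ⟨mem_gridCell_floor x, ?_⟩
  rcases hx with ⟨n, hn⟩ | ⟨n, hn⟩
  · left
    rw [hn, mul_one, Int.floor_intCast]
  · right; right; left
    rw [hn, mul_one, Int.floor_intCast]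

lemma corner_mem_gridCellBoundary (i j : ℤ) : gridPoint i j ∈ gridCellBoundary i j := by
  simp [gridPoint, gridCellBoundary, gridCell]

lemma smul_mem_gridCell_ediv {x : ℝ × ℝ} {i j : ℤ} {M : ℕ} (hM : 0 < M) (hx : x ∈ gridCell i j) :
    (1 / (M : ℝ)) • x ∈ gridCell (i / M) (j / M) := by
  have hM' : (0 : ℝ) < M := by exact_mod_cast hM
  have key : ∀ (a : ℤ) (s : ℝ), s ∈ Icc (a : ℝ) (a + 1) →
      1 / (M : ℝ) * s ∈ Icc ((a / M : ℤ) : ℝ) ((a / M : ℤ) + 1) := by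
    intro a s hs
    have h1 : ((a / M : ℤ) : ℝ) * M ≤ a := by
      exact_mod_cast Int.ediv_mul_le a (by omega)
    have h2 : (a : ℝ) + 1 ≤ ((a / M : ℤ) + 1) * M := by
      exact_mod_cast Int.lt_ediv_add_one_mul_self a (by omega : (0 : ℤ) < M)
    rw [one_div_mul_eq_div]
    exact ⟨(le_div_iff₀ hM').2 (h1.trans hs.1), (div_le_iff₀ hM').2 (hs.2.trans h2)⟩
  exact ⟨key i _ hx.1, key j _ hx.2⟩

/-- Good cells can be subdivided into better cells by a small change of the map. -/
lemma exists_refinement {B : Set (ℝ × ℝ)} {f : ℝ × ℝ → ℝ × ℝ} (hf : Continuous f) {N : ℕ}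
    {ε ε' : ℝ} (hε : 0 < ε) (hε' : 0 < ε')
    (hgood : ∀ i ∈ Ico (0 : ℤ) N, ∀ j ∈ Ico (0 : ℤ) N, CellGood (filled B) ε f i j) :
    ∃ M : ℕ, 0 < M ∧ ∃ f' : ℝ × ℝ → ℝ × ℝ, Continuous f' ∧
      (∀ i ∈ Ico (0 : ℤ) (N * M : ℕ), ∀ j ∈ Ico (0 : ℤ) (N * M : ℕ),
        CellGood (filled B) ε' f' i j) ∧
      (∀ x, dist (f' ((M : ℝ) • x)) (f x) ≤ 2 * ε + ε') ∧
      ∀ x ∈ gridLines 1, f' ((M : ℝ) • x) = f x := by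
  classical
  set u : ℤ → ℤ → ℝ × ℝ → ℝ × ℝ := fun i j x => f (x + gridPoint i j) with hu
  have huc : ∀ i j, Continuous (u i j) := fun i j => hf.comp (by fun_prop)
  have hui : ∀ i j, u i j '' gridCellBoundary 0 0 ⊆ f '' gridCellBoundary i j := by
    rintro i j _ ⟨x, hx, rfl⟩
    refine mem_image_of_mem f ?_
    have := sub_mem_gridCellBoundary (x := x + gridPoint i j) (i := 0) (j := 0) (k := i) (l := j)
    rw [add_sub_cancel_right, zero_add, zero_add] at this
    exact this.1 hx
  choose N₀ hN₀ using fun i j => exists_cellGood_filled (huc i j) hε'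
  set M : ℕ := (Finset.Ico (0 : ℤ) N ×ˢ Finset.Ico (0 : ℤ) N).sup (fun n => N₀ n.1 n.2) + 1 with hM
  have hMpos : 0 < M := Nat.succ_pos _
  have hM' : (M : ℝ) ≠ 0 := by exact_mod_cast hMpos.ne'
  have hMle : ∀ i ∈ Ico (0 : ℤ) N, ∀ j ∈ Ico (0 : ℤ) N, N₀ i j ≤ M := fun i hi j hj =>
    (Finset.le_sup (f := fun n : ℤ × ℤ => N₀ n.1 n.2) (b := (i, j)) (by
      simpa using ⟨hi, hj⟩)).trans (Nat.le_succ _)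
  set D : Set (ℤ × ℤ) := {n | n.1 ∈ Ico (0 : ℤ) N ∧ n.2 ∈ Ico (0 : ℤ) N ∧
    ¬ MapsTo f (gridCell n.1 n.2) (filled B)} with hD
  have hv : ∀ i j, ∃ v : ℝ × ℝ → ℝ × ℝ, (i, j) ∈ D → Continuous v ∧
      (∀ k l, CellGood (filled (u i j '' gridCellBoundary 0 0)) ε' v k l) ∧
      ∀ x ∈ gridCellBoundary 0 0, v ((M : ℝ) • x) = u i j x := by
    intro i j
    by_cases h : (i, j) ∈ D
    · obtain ⟨v, hv⟩ := hN₀ i j M (hMle i h.1 j h.2.1) hMpos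
      exact ⟨v, fun _ => hv⟩
    · exact ⟨f, fun h' => absurd h' h⟩
  choose v hvD using hv
  set φ : ℤ → ℤ → ℝ × ℝ → ℝ × ℝ := fun i j =>
    if (i, j) ∈ D then fun x => v i j ((M : ℝ) • (x - gridPoint i j)) else f with hφ
  have hφD : ∀ i j, (i, j) ∈ D → φ i j = fun x => v i j ((M : ℝ) • (x - gridPoint i j)) :=
    fun i j h => if_pos h
  have hφf : ∀ i j, (i, j) ∉ D → φ i j = f := fun i j h => if_neg h
  have hφb : ∀ i j, EqOn (φ i j) f (gridCellBoundary i j) := by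
    intro i j x hx
    by_cases h : (i, j) ∈ D
    · rw [hφD i j h]
      have h1 : x - gridPoint i j ∈ gridCellBoundary 0 0 := by
        rw [sub_mem_gridCellBoundary]
        simpa using hx
      simp only [(hvD i j h).2.2 _ h1, hu, sub_add_cancel]
    · rw [hφf i j h]
  obtain ⟨Φ, hΦ, hΦφ⟩ := exists_continuous_replace_cells (φ := φ) (f := f)
    (fun i j => by
      by_cases h : (i, j) ∈ D
      · rw [hφD i j h]
        exact (hvD i j h).1.comp (by fun_prop)
      · rwa [hφf i j h]) hφb
  have hWW : ∀ i j, (i, j) ∈ D → CellGood (filled B) ε f i j ∧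
      filled (u i j '' gridCellBoundary 0 0) ⊆ filled B ∧
      filled (u i j '' gridCellBoundary 0 0) ⊆ closedBall (f (gridPoint i j)) ε := by
    intro i j h
    have h1 := hgood i h.1 j h.2.1
    obtain ⟨h2, h3⟩ := h1.resolve_left h.2.2
    refine ⟨h1, filled_subset_filled ((hui i j).trans (image_subset_iff.2 h2)),
      filled_subset_closedBall ((hui i j).trans (image_subset_iff.2 fun x hx => ?_)) hε.le⟩
    exact h3 x hx.1 _ (corner_mem_gridCellBoundary i j).1
  refine ⟨M, hMpos, fun x => Φ ((1 / (M : ℝ)) • x), hΦ.comp (by fun_prop), ?_, ?_, ?_⟩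
  · intro i hi j hj
    have hdiv : ∀ a ∈ Ico (0 : ℤ) (N * M : ℕ), a / M ∈ Ico (0 : ℤ) N := fun a ha =>
      ⟨Int.ediv_nonneg ha.1 (by omega),
        Int.ediv_lt_of_lt_mul (by omega) (by exact_mod_cast ha.2)⟩
    have hcell := fun x (hx : x ∈ gridCell i j) => smul_mem_gridCell_ediv hMpos hx
    by_cases h : (i / (M : ℤ), j / (M : ℤ)) ∈ D
    · have hmod : ∀ a : ℤ, a % M + a / M * M = a := fun a => by
        rw [mul_comm, Int.emod_add_mul_ediv]
      have hval : ∀ x ∈ gridCell i j, Φ ((1 / (M : ℝ)) • x) =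
          v (i / M) (j / M) (x - gridPoint (i / M * M) (j / M * M)) := by
        intro x hx
        rw [hΦφ _ _ (hcell x hx), hφD _ _ h]
        simp only
        rw [smul_sub, smul_smul, mul_one_div_cancel hM', one_smul]
        congr 2
        ext <;> simp [gridPoint, mul_comm]
      have hsub : ∀ x ∈ gridCell i j,
          x - gridPoint (i / M * M) (j / M * M) ∈ gridCell (i % M) (j % M) := fun x hx => by
        rwa [sub_mem_gridCell, hmod, hmod]
      refine ((hvD _ _ h).2.1 (i % M) (j % M)).imp (fun h1 x hx => ?_) fun h1 => ⟨fun x hx => ?_,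
        fun x hx y hy => ?_⟩
      · simp only [hval x hx]
        exact (hWW _ _ h).2.1 (h1 (hsub x hx))
      · simp only [hval x hx.1]
        refine (hWW _ _ h).2.1 (h1.1 ?_)
        rwa [sub_mem_gridCellBoundary, hmod, hmod]
      · simp only [hval x hx, hval y hy]
        exact h1.2 _ (hsub x hx) _ (hsub y hy)
    · left
      intro x hx
      simp only [hΦφ _ _ (hcell x hx), hφf _ _ h]
      by_contra hcon
      exact h ⟨hdiv i hi, hdiv j hj, fun h' => hcon (h' (hcell x hx))⟩
  · intro x
    simp only [smul_smul, one_div_mul_cancel hM', one_smul]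
    have hx := mem_gridCell_floor x
    set i := ⌊x.1⌋
    set j := ⌊x.2⌋
    rw [hΦφ i j hx]
    by_cases h : (i, j) ∈ D
    swap
    · rw [hφf i j h, dist_self]
      positivity
    rw [hφD i j h]
    obtain ⟨hg, -, hball⟩ := hWW i j h
    have h1 : dist (f x) (f (gridPoint i j)) ≤ ε :=
      (hg.resolve_left h.2.2).2 x hx _ (corner_mem_gridCellBoundary i j).1
    set y := (M : ℝ) • (x - gridPoint i j)
    have h2 : dist (v i j y) (f (gridPoint i j)) ≤ ε + ε' := by
      rcases (hvD i j h).2.1 ⌊y.1⌋ ⌊y.2⌋ with hy | ⟨hy, hy'⟩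
      · linarith [mem_closedBall.1 (hball (hy (mem_gridCell_floor y)))]
      · have hc := corner_mem_gridCellBoundary ⌊y.1⌋ ⌊y.2⌋
        linarith [mem_closedBall.1 (hball (hy hc)), hy' y (mem_gridCell_floor y) _ hc.1,
          dist_triangle (v i j y) (v i j (gridPoint ⌊y.1⌋ ⌊y.2⌋)) (f (gridPoint i j))]
    linarith [dist_triangle_right (v i j y) (f x) (f (gridPoint i j))]
  · intro x hx
    simp only [smul_smul, one_div_mul_cancel hM', one_smul]
    have hx' := mem_gridCellBoundary_floor hx
    rw [hΦφ _ _ hx'.1]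
    exact hφb _ _ hx'

end Refine

section Fill

lemma smul_mem_gridLines_one {x : ℝ × ℝ} (hx : x ∈ gridLines 1) (N : ℕ) :
    (N : ℝ) • x ∈ gridLines 1 := by
  rcases hx with ⟨n, hn⟩ | ⟨n, hn⟩
  · exact .inl ⟨N * n, by simp [hn]⟩
  · exact .inr ⟨N * n, by simp [hn]⟩

lemma gridCellBoundary_subset_gridLines (i j : ℤ) : gridCellBoundary i j ⊆ gridLines 1 := by
  rintro x ⟨-, h | h | h | h⟩
  exacts [.inl ⟨i, by simp [h]⟩, .inl ⟨i + 1, by simp [h]⟩, .inr ⟨j, by simp [h]⟩,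
    .inr ⟨j + 1, by simp [h]⟩]

/-- A loop in a closed filled set bounds a disk in this set. -/
lemma exists_continuous_mapsTo_filled {B : Set (ℝ × ℝ)} (hB : IsClosed B) {f : ℝ × ℝ → ℝ × ℝ}
    (hf : Continuous f) (hfB : MapsTo f (gridCellBoundary 0 0) (filled B)) :
    ∃ F : ℝ × ℝ → ℝ × ℝ, Continuous F ∧ EqOn F f (gridCellBoundary 0 0) ∧
      MapsTo F (gridCell 0 0) (filled B) := by
  obtain ⟨C, hCpos, hC⟩ : ∃ C > 0, ∀ x ∈ gridCell 0 0, ∀ y ∈ gridCell 0 0, dist (f x) (f y) ≤ C := by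
    obtain ⟨C, hC⟩ := Metric.isBounded_iff.1 ((isCompact_gridCell 0 0).image hf).isBounded
    exact ⟨max C 1, by positivity, fun x hx y hy =>
      (hC (mem_image_of_mem f hx) (mem_image_of_mem f hy)).trans (le_max_left _ _)⟩
  set P : ℕ → ℕ × (ℝ × ℝ → ℝ × ℝ) → Prop := fun n s => 0 < s.1 ∧ Continuous s.2 ∧
    ∀ i ∈ Ico (0 : ℤ) s.1, ∀ j ∈ Ico (0 : ℤ) s.1, CellGood (filled B) (C / 2 ^ n) s.2 i j with hP
  have hstep : ∀ n s, P n s → ∃ s', P (n + 1) s' ∧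
      (∀ x, dist (s'.2 ((s'.1 : ℝ) • x)) (s.2 ((s.1 : ℝ) • x)) ≤ 3 * (C / 2 ^ n)) ∧
      ∀ x ∈ gridLines 1, s'.2 ((s'.1 : ℝ) • x) = s.2 ((s.1 : ℝ) • x) := by
    rintro n ⟨N, g⟩ ⟨hN, hg, hgood⟩
    obtain ⟨M, hM, g', hg', hgood', hd, he⟩ := exists_refinement hg
      (show 0 < C / 2 ^ n by positivity) (show 0 < C / 2 ^ (n + 1) by positivity) hgood
    have hMN : ∀ x : ℝ × ℝ, ((N * M : ℕ) : ℝ) • x = (M : ℝ) • (N : ℝ) • x := fun x => by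
      rw [smul_smul, Nat.cast_mul, mul_comm]
    refine ⟨(N * M, g'), ⟨Nat.mul_pos hN hM, hg', hgood'⟩, fun x => ?_, fun x hx => ?_⟩
    · simp only [hMN]
      refine (hd _).trans ?_
      have : C / 2 ^ (n + 1) ≤ C / 2 ^ n := by gcongr <;> simp
      linarith
    · simp only [hMN]
      exact he _ (smul_mem_gridLines_one hx N)
  choose! next hnext hnextd hnexte using hstep
  set s : ℕ → ℕ × (ℝ × ℝ → ℝ × ℝ) := fun n => Nat.rec (1, f) next n with hs
  have hsP : ∀ n, P n (s n) := by
    intro n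
    induction n with
    | zero =>
      refine ⟨one_pos, hf, fun i hi j hj => ?_⟩
      obtain rfl : i = 0 := by have := hi.1; have := hi.2; simp [hs] at *; omega
      obtain rfl : j = 0 := by have := hj.1; have := hj.2; simp [hs] at *; omega
      exact .inr ⟨hfB, by rw [pow_zero, div_one]; exact hC⟩
    | succ n ih => exact hnext n _ ih
  set F : ℕ → ℝ × ℝ → ℝ × ℝ := fun n x => (s n).2 (((s n).1 : ℝ) • x) with hF
  have hFd : ∀ x n, dist (F n x) (F (n + 1) x) ≤ 6 * C / 2 / 2 ^ n := by
    intro x n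
    rw [dist_comm]
    exact (hnextd n _ (hsP n) x).trans_eq (by ring)
  choose L hL using fun x => cauchySeq_tendsto_of_complete (cauchySeq_of_le_geometric_two (hFd x))
  have hLd : ∀ n x, dist (F n x) (L x) ≤ 6 * C / 2 ^ n := fun n x =>
    dist_le_of_le_geometric_two_of_tendsto (hFd x) (hL x) n
  have hpow : ∀ c : ℝ, Tendsto (fun n : ℕ => c / 2 ^ n) atTop (𝓝 0) := fun c => by
    simpa [div_eq_mul_inv] using (tendsto_pow_atTop_nhds_zero_of_lt_one (r := (2 : ℝ)⁻¹)
      (by norm_num) (by norm_num)).const_mul c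
  have hunif : TendstoUniformly F L atTop := by
    rw [Metric.tendstoUniformly_iff]
    intro ε hε
    filter_upwards [(hpow (6 * C)).eventually_lt_const hε] with n hn x
    rw [dist_comm]
    exact (hLd n x).trans_lt hn
  have hLc : Continuous L := hunif.continuous
    (Frequently.of_forall fun n => (hsP n).2.1.comp (by fun_prop))
  have hbd : EqOn L f (gridLines 1) := by
    intro x hx
    have : ∀ n, F n x = f x := by
      intro n
      induction n with
      | zero => simp [hF, hs]
      | succ n ih => exact (hnexte n _ (hsP n) x hx).trans ih
    exact tendsto_nhds_unique (hL x) (by simp [this])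
  refine ⟨L, hLc, hbd.mono (gridCellBoundary_subset_gridLines 0 0), fun x hx => ?_⟩
  by_cases hxb : x ∈ gridCellBoundary 0 0
  · rw [hbd (gridCellBoundary_subset_gridLines 0 0 hxb)]
    exact hfB hxb
  have hx0 : x.1 ∈ Ico (0 : ℝ) 1 ∧ x.2 ∈ Ico (0 : ℝ) 1 := by
    have h1 : ¬ (_ ∨ _) := fun h => hxb ⟨hx, h⟩
    simp only [gridCell, mem_prod, mem_Icc, Int.cast_zero, zero_add, not_or] at hx h1
    exact ⟨⟨hx.1.1, hx.1.2.lt_of_ne h1.2.1⟩, ⟨hx.2.1, hx.2.2.lt_of_ne h1.2.2.2⟩⟩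
  have hq : ∀ n, ∃ q ∈ filled B, dist (F n x) q ≤ C / 2 ^ n := by
    intro n
    obtain ⟨hN, -, hgood⟩ := hsP n
    have hfl : ∀ t ∈ Ico (0 : ℝ) 1, ⌊((s n).1 : ℝ) * t⌋ ∈ Ico (0 : ℤ) (s n).1 := fun t ht => by
      have hN' : (0 : ℝ) < (s n).1 := by exact_mod_cast hN
      refine ⟨Int.floor_nonneg.2 (mul_nonneg hN'.le ht.1), Int.floor_lt.2 ?_⟩
      push_cast
      nlinarith [ht.2]
    have hc := mem_gridCell_floor (((s n).1 : ℝ) • x)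
    have hb := corner_mem_gridCellBoundary ⌊(((s n).1 : ℝ) • x).1⌋ ⌊(((s n).1 : ℝ) • x).2⌋
    rcases hgood _ (hfl _ hx0.1) _ (hfl _ hx0.2) with h | ⟨h1, h2⟩
    · exact ⟨_, h hc, by rw [dist_self]; positivity⟩
    · exact ⟨_, h1 hb, h2 _ hc _ hb.1⟩
  choose q hqB hqd using hq
  have h0 : Tendsto (fun n => dist (F n x) (q n)) atTop (𝓝 0) :=
    squeeze_zero (fun _ => dist_nonneg) hqd (hpow C)
  exact (isClosed_filled hB).mem_of_tendsto ((tendsto_iff_of_dist h0).1 (hL x)) (.of_forall hqB)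

lemma isSimplyConnected_filled {K : Set (ℝ × ℝ)} (hK : IsClosed K) (hKp : IsPathConnected K) :
    IsSimplyConnected (filled K) := by
  rw [isSimplyConnected_iff_exists_homotopy_refl_forall_mem]
  refine ⟨isPathConnected_filled hK hKp, fun x p hp => ?_⟩
  have hpe : ∀ t, p.extend t ∈ filled K := fun t => by
    have : p.extend t ∈ range p.extend := mem_range_self t
    rw [Path.extend_range] at this
    obtain ⟨s, hs⟩ := this
    exact hs ▸ hp s
  have hx : x ∈ filled K := by simpa using hp 0
  obtain ⟨F, hF, hFb, hFK⟩ := exists_continuous_mapsTo_filled hK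
    (f := fun y => (1 - y.1) • p.extend y.2 + y.1 • x)
    (by have := p.continuous_extend; fun_prop) (by
      rintro ⟨s, t⟩ ⟨-, h⟩
      simp only [Int.cast_zero, zero_add] at h
      rcases h with rfl | rfl | rfl | rfl
      · simpa using hpe t
      · simpa using hx
      · simpa [← add_smul] using hx
      · simpa [← add_smul] using hx)
  have hmem : ∀ s t : unitInterval, ((s, t) : ℝ × ℝ) ∈ gridCell 0 0 := fun s t => by
    simp [gridCell, s.2.1, s.2.2, t.2.1, t.2.2]
  refine ⟨⟨⟨⟨fun y => F (y.1, y.2), by fun_prop⟩, fun t => ?_, fun t => ?_⟩, fun s t ht => ?_⟩,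
    fun y => hFK (hmem y.1 y.2)⟩
  · exact (hFb ⟨hmem 0 t, by simp⟩).trans (by simp)
  · exact (hFb ⟨hmem 1 t, by simp⟩).trans (by simp)
  · rcases ht with rfl | rfl
    · exact (hFb ⟨hmem s 0, by simp⟩).trans (by simp [← add_smul])
    · exact (hFb ⟨hmem s 1, by simp⟩).trans (by simp [← add_smul])

lemma filled_eq_union_sUnion {E : Type*} [NormedAddCommGroup E] (K : Set E) :
    filled K = K ∪ ⋃₀ {C | (∃ x ∈ Kᶜ, C = connectedComponentIn Kᶜ x) ∧ IsBounded C} := by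
  refine congrArg (K ∪ ·) (Subset.antisymm ?_ ?_)
  · rintro x ⟨hx, hb⟩
    exact ⟨_, ⟨⟨x, hx, rfl⟩, hb⟩, mem_connectedComponentIn hx⟩
  · rintro y ⟨_, ⟨⟨x, -, rfl⟩, hb⟩, hy⟩
    refine ⟨connectedComponentIn_subset _ _ hy, ?_⟩
    rwa [connectedComponentIn_eq hy] at hb

end Fill

end FillingLoops

/-- The union `W` of the image of an immersed closed C¹ curve in the plane (modeled as a
1-periodic map) with finitely many transverse self-intersections (each with finite fiber)
together with all bounded connected components of the complement of the image is compact,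
connected and simply connected. -/
theorem immersed_curve_filled_region_compact_connected_simplyConnected
    (γ : ℝ → ℝ × ℝ)
    (hper : Periodic γ 1)
    (hC1 : ContDiff ℝ 1 γ)
    (himm : ∀ t : ℝ, deriv γ t ≠ 0)
    (htrans : ∀ s ∈ Ico (0:ℝ) 1, ∀ t ∈ Ico (0:ℝ) 1, s ≠ t → γ s = γ t →
      LinearIndependent ℝ ![deriv γ s, deriv γ t])
    (S : Set (ℝ × ℝ))
    (hS : S = {p | ∃ s ∈ Ico (0:ℝ) 1, ∃ t ∈ Ico (0:ℝ) 1, s ≠ t ∧ γ s = p ∧ γ t = p})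
    (hSfin : S.Finite)
    (hfib : ∀ p ∈ S, (γ ⁻¹' {p} ∩ Ico (0:ℝ) 1).Finite)
    (W : Set (ℝ × ℝ))
    (hW : W = range γ ∪
      ⋃₀ {C : Set (ℝ × ℝ) |
        (∃ x ∈ (range γ)ᶜ, C = connectedComponentIn (range γ)ᶜ x) ∧ IsBounded C}) :
    IsCompact W ∧ IsConnected W ∧ SimplyConnectedSpace W := by
  rw [← filled_eq_union_sUnion] at hW
  subst hW
  have hγ := hC1.continuous
  have hK : IsCompact (range γ) := by
    rw [← hper.image_Icc one_pos 0]
    exact isCompact_Icc.image hγ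
  have hKp : IsPathConnected (range γ) := isPathConnected_range hγ
  exact ⟨Metric.isCompact_of_isClosed_isBounded (isClosed_filled hK.isClosed)
    (isBounded_filled hK.isBounded), (isPathConnected_filled hK.isClosed hKp).isConnected,
    isSimplyConnected_filled hK.isClosed hKp⟩
end

section
/- Let g, m be positive integers, set n = mg + 1, and let c > 0 be a real constant. Define the function K on (0,∞) × (0, π/g) by K(r, φ) = (e^{r²/2} / (c² r^{2n} sin(gφ)^{2m})) · ( r² + (n−1)g / sin²(gφ) ). Let y = ((n−1)(2−g) + √((g−2)²(n−1)² + 8ng(n−1)))/2 and κ = (e^{y/2} / (c² yⁿ)) · ( y + (n−1)g ). Then K(r, φ) ≥ κ for all r > 0 and φ ∈ (0, π/g), and equality is attained at r = √y, φ = π/(2g). In particular κ > 0 is the minimum of K. -/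
open Set Real

/-- A positive root `y` of `y² + (A - 2N) y = 2(N+1)A` minimises `exp (x/2) (x + A) / x ^ (N+1)`
over the positive reals. -/
lemma exp_half_mul_add_div_pow_le {N : ℕ} {A x y : ℝ} (hA : 0 < A) (hx : 0 < x) (hy : 0 < y)
    (h : y ^ 2 + (A - 2 * N) * y = 2 * (N + 1) * A) :
    exp (y / 2) * (y + A) / y ^ (N + 1) ≤ exp (x / 2) * (x + A) / x ^ (N + 1) := by
  have h1 : (x / y) ^ N ≤ exp (N * (x / y - 1)) := by
    rw [exp_nat_mul]
    have := add_one_le_exp (x / y - 1)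
    exact pow_le_pow_left₀ (by positivity) (by linarith) N
  have h2 : x / y * ((y + A) / (x + A)) ≤ exp (A * (x / y - 1) / (y + A)) := by
    have h3 : x / y * ((y + A) / (x + A)) - 1 ≤ A * (x / y - 1) / (y + A) := by
      have : A * (x / y - 1) / (y + A) - (x / y * ((y + A) / (x + A)) - 1) =
          A * (x - y) ^ 2 / (y * (x + A) * (y + A)) := by
        field_simp
        ring
      have : 0 ≤ A * (x - y) ^ 2 / (y * (x + A) * (y + A)) := by positivity
      linarith
    have := add_one_le_exp (A * (x / y - 1) / (y + A))
    linarith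
  have h4 : N * (x / y - 1) + A * (x / y - 1) / (y + A) = x / 2 - y / 2 := by
    field_simp
    linear_combination (y - x) * h
  have h5 : (x / y) ^ N * (x / y * ((y + A) / (x + A))) ≤ exp (x / 2) / exp (y / 2) := by
    rw [← exp_sub, ← h4, exp_add]
    exact mul_le_mul h1 h2 (by positivity) (exp_pos _).le
  have h6 : (x / y) ^ N * (x / y * ((y + A) / (x + A))) =
      x ^ (N + 1) * (y + A) / (y ^ (N + 1) * (x + A)) := by
    rw [div_pow, pow_succ, pow_succ]
    field_simp
  rw [h6, div_le_div_iff₀ (by positivity) (exp_pos _)] at h5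
  rw [div_le_div_iff₀ (by positivity) (by positivity)]
  linarith

/-- The Gaussian curvature `K` of the reduced metric for isoparametric foliations of type
`(g, m, m)` is bounded below on the strip `(0,∞) × (0, π/g)` by the explicit constant
`κ = κ_{g,m}`, with equality attained at `r = √y`, `φ = π/(2g)`; in particular `κ > 0`
is the minimum of `K`. -/
theorem curvature_lower_bound_kappa
    (g m : ℕ) (hg : 0 < g) (hm : 0 < m) (n : ℕ) (hn : n = m * g + 1)
    (c : ℝ) (hc : 0 < c)
    (K : ℝ → ℝ → ℝ)
    (hK : ∀ r φ : ℝ, K r φ =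
      Real.exp (r ^ 2 / 2) / (c ^ 2 * r ^ (2 * n) * Real.sin (g * φ) ^ (2 * m)) *
        (r ^ 2 + ((n : ℝ) - 1) * g / Real.sin (g * φ) ^ 2))
    (y κ : ℝ)
    (hy : y = (((n : ℝ) - 1) * (2 - (g : ℝ)) +
      Real.sqrt (((g : ℝ) - 2) ^ 2 * ((n : ℝ) - 1) ^ 2 + 8 * n * g * ((n : ℝ) - 1))) / 2)
    (hκ : κ = Real.exp (y / 2) / (c ^ 2 * y ^ n) * (y + ((n : ℝ) - 1) * g)) :
    (∀ r ∈ Ioi (0 : ℝ), ∀ φ ∈ Ioo (0 : ℝ) (π / g), κ ≤ K r φ) ∧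
    K (Real.sqrt y) (π / (2 * g)) = κ ∧ 0 < κ := by
  obtain ⟨N, hN⟩ : ∃ N, N = m * g := ⟨_, rfl⟩
  rw [← hN] at hn
  subst hn
  have hN0 : (0 : ℝ) < N := by
    rw [hN]
    exact_mod_cast Nat.mul_pos hm hg
  have hg0 : (0 : ℝ) < g := by exact_mod_cast hg
  push_cast at hK hy hκ
  simp only [add_sub_cancel_right] at hK hy hκ
  obtain ⟨A, hA⟩ : ∃ A : ℝ, A = N * g := ⟨_, rfl⟩
  have hA0 : 0 < A := hA ▸ mul_pos hN0 hg0
  rw [← hA] at hκ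
  simp only [← hA] at hK
  set D : ℝ := ((g : ℝ) - 2) ^ 2 * (N : ℝ) ^ 2 + 8 * (N + 1) * g * N with hD
  have hDpos : (N * ((g : ℝ) - 2)) ^ 2 < D := by
    have : 0 < 8 * ((N : ℝ) + 1) * g * N := by positivity
    rw [hD]
    linarith [mul_pow (N : ℝ) ((g : ℝ) - 2) 2]
  have hy0 : 0 < y := by
    have := lt_sqrt_of_sq_lt hDpos
    rw [hy]
    linarith
  have hquad : y ^ 2 + (A - 2 * N) * y = 2 * (N + 1) * A := by
    have hs : √D ^ 2 = D := sq_sqrt ((sq_nonneg _).trans hDpos.le)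
    rw [hy, hA]
    linear_combination hs / 4 + hD / 4
  have hκ' : κ = exp (y / 2) * (y + A) / y ^ (N + 1) / c ^ 2 := by
    rw [hκ]
    field_simp
  refine ⟨fun r hr φ hφ => ?_, ?_, ?_⟩
  · have hr0 : 0 < r := hr
    have hsin : 0 < sin (g * φ) := by
      refine sin_pos_of_pos_of_lt_pi (mul_pos hg0 hφ.1) ?_
      have := (lt_div_iff₀ hg0).1 hφ.2
      linarith
    have hs1 : sin (g * φ) ^ 2 ≤ 1 := sin_sq_le_one _
    have hsm : sin (g * φ) ^ (2 * m) ≤ 1 := pow_le_one₀ hsin.le (sin_le_one _)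
    calc κ ≤ exp (r ^ 2 / 2) * (r ^ 2 + A) / (r ^ 2) ^ (N + 1) / c ^ 2 := by
          rw [hκ']
          refine div_le_div_of_nonneg_right ?_ (sq_nonneg c)
          exact exp_half_mul_add_div_pow_le hA0 (by positivity) hy0 hquad
      _ = exp (r ^ 2 / 2) / (c ^ 2 * r ^ (2 * (N + 1))) * (r ^ 2 + A) := by
          rw [pow_mul r 2]
          field_simp
      _ ≤ K r φ := by
          rw [hK]
          refine mul_le_mul ?_ ?_ (by positivity) (by positivity)
          · refine div_le_div_of_nonneg_left (exp_pos _).le (by positivity) ?_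
            exact mul_le_of_le_one_right (by positivity) hsm
          · linarith [le_div_self hA0.le (by positivity) hs1]
  · have harg : (g : ℝ) * (π / (2 * g)) = π / 2 := by field_simp
    rw [hK, harg, sin_pi_div_two, pow_mul (√y) 2, sq_sqrt hy0.le, hκ]
    simp
  · rw [hκ]
    positivity
end

section
/- Let g, m be positive integers and set n = mg + 1. Define f : (0,∞) → ℝ by f(u) = e^{u/2} (u + (n−1)g) / uⁿ, and let y = ((n−1)(2−g) + √((g−2)²(n−1)² + 8ng(n−1)))/2. Then y > 0, f(u) ≥ f(y) for every u > 0, and equality holds if and only if u = y; i.e., y is the unique global minimizer of f on (0,∞). -/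
open Set Real

/-- The derivative of `log (e^{u/2} (u + a) / u ^ n)`, with numerator factored through a
critical point `y`. -/
lemma hasDerivAt_half_add_log_sub_log {a N y u : ℝ} (ha : 0 < a) (hu : 0 < u)
    (hcrit : y * (y + a + 2 - 2 * N) = 2 * N * a) :
    HasDerivAt (fun u : ℝ => u / 2 + log (u + a) - N * log u)
      ((u - y) * (u + (y + a + 2 - 2 * N)) / (2 * u * (u + a))) u := by
  have hua : u + a ≠ 0 := by positivity
  have h := (((hasDerivAt_id u).div_const 2).add (((hasDerivAt_id u).add_const a).log hua)).sub
    ((hasDerivAt_log hu.ne').const_mul N)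
  refine h.congr_deriv ?_
  simp only [id]
  field_simp
  linear_combination hcrit

/-- A positive critical point of `u / 2 + log (u + a) - N log u` is its strict minimizer on the
positive reals. -/
lemma half_add_log_sub_log_lt {a N y u : ℝ} (ha : 0 < a) (hN : 0 < N) (hy : 0 < y)
    (hcrit : y * (y + a + 2 - 2 * N) = 2 * N * a) (hu : 0 < u) (huy : u ≠ y) :
    y / 2 + log (y + a) - N * log y < u / 2 + log (u + a) - N * log u := by
  have hz : 0 < y + a + 2 - 2 * N :=
    pos_of_mul_pos_right (hcrit ▸ by positivity) hy.le
  have hd {x : ℝ} (hx : 0 < x) := hasDerivAt_half_add_log_sub_log ha hx hcrit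
  rcases lt_or_gt_of_ne huy with h | h
  · have hanti : StrictAntiOn (fun u : ℝ => u / 2 + log (u + a) - N * log u) (Icc u y) := by
      refine strictAntiOn_of_deriv_neg (convex_Icc u y)
        (fun x hx => (hd (hu.trans_le hx.1)).continuousAt.continuousWithinAt) fun x hx => ?_
      rw [interior_Icc] at hx
      have hx0 : 0 < x := hu.trans hx.1
      rw [(hd hx0).deriv]
      exact div_neg_of_neg_of_pos
        (mul_neg_of_neg_of_pos (sub_neg.2 hx.2) (by positivity)) (by positivity)
    exact hanti (left_mem_Icc.2 h.le) (right_mem_Icc.2 h.le) h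
  · have hmono : StrictMonoOn (fun u : ℝ => u / 2 + log (u + a) - N * log u) (Icc y u) := by
      refine strictMonoOn_of_deriv_pos (convex_Icc y u)
        (fun x hx => (hd (hy.trans_le hx.1)).continuousAt.continuousWithinAt) fun x hx => ?_
      rw [interior_Icc] at hx
      have hx0 : 0 < x := hy.trans hx.1
      rw [(hd hx0).deriv]
      exact div_pos (mul_pos (sub_pos.2 hx.1) (by positivity)) (by positivity)
    exact hmono (left_mem_Icc.2 h.le) (right_mem_Icc.2 h.le) h

/-- The function `f(u) = e^{u/2}(u + (n−1)g)/uⁿ` on `(0,∞)` has the explicit value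
`y = y_{g,m}` as its unique global minimizer. -/
theorem unique_minimizer_of_f
    (g m : ℕ) (hg : 0 < g) (hm : 0 < m) (n : ℕ) (hn : n = m * g + 1)
    (f : ℝ → ℝ)
    (hf : ∀ u : ℝ, f u = Real.exp (u / 2) * (u + ((n : ℝ) - 1) * g) / u ^ n)
    (y : ℝ)
    (hy : y = (((n : ℝ) - 1) * (2 - (g : ℝ)) +
      Real.sqrt (((g : ℝ) - 2) ^ 2 * ((n : ℝ) - 1) ^ 2 + 8 * n * g * ((n : ℝ) - 1))) / 2) :
    0 < y ∧ ∀ u : ℝ, 0 < u → f y ≤ f u ∧ (f u = f y ↔ u = y) := by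
  have hg' : (0 : ℝ) < g := by exact_mod_cast hg
  have hn1 : (0 : ℝ) < (n : ℝ) - 1 := by
    have : (0 : ℝ) < m := by exact_mod_cast hm
    rw [hn]
    push_cast
    rw [add_sub_cancel_right]
    positivity
  have hn0 : (0 : ℝ) < n := by linarith
  have ha : 0 < ((n : ℝ) - 1) * g := mul_pos hn1 hg'
  have hgap : 0 < 8 * (n : ℝ) * g * ((n : ℝ) - 1) := by positivity
  have hsq := Real.sq_sqrt (show 0 ≤ ((g : ℝ) - 2) ^ 2 * ((n : ℝ) - 1) ^ 2 +
    8 * n * g * ((n : ℝ) - 1) by positivity)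
  have hy0 : 0 < y := by
    have : ((n : ℝ) - 1) * ((g : ℝ) - 2) < Real.sqrt (((g : ℝ) - 2) ^ 2 * ((n : ℝ) - 1) ^ 2 +
        8 * n * g * ((n : ℝ) - 1)) := Real.lt_sqrt_of_sq_lt (by linarith)
    rw [hy]
    linarith
  have hcrit : y * (y + ((n : ℝ) - 1) * g + 2 - 2 * n) = 2 * n * (((n : ℝ) - 1) * g) := by
    rw [hy]
    linear_combination hsq / 4
  have hexp {u : ℝ} (hu : 0 < u) :
      f u = exp (u / 2 + log (u + ((n : ℝ) - 1) * g) - n * log u) := by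
    rw [hf, exp_sub, exp_add, exp_log (by positivity), exp_nat_mul, exp_log hu]
  have hlt {u : ℝ} (hu : 0 < u) (huy : u ≠ y) : f y < f u := by
    rw [hexp hu, hexp hy0]
    exact exp_lt_exp.2 (half_add_log_sub_log_lt ha hn0 hy0 hcrit hu huy)
  refine ⟨hy0, fun u hu => ?_⟩
  rcases eq_or_ne u y with rfl | huy
  · simp
  · exact ⟨(hlt hu huy).le, iff_of_false (hlt hu huy).ne' huy⟩
end

section
/- Let g, m be positive integers, set n = mg + 1, and let c > 0. Define K(r, φ) = (e^{r²/2} / (c² r^{2n} sin(gφ)^{2m})) · ( r² + (n−1)g / sin²(gφ) ) on the open set U = (0,∞) × (0, π/g) ⊂ ℝ². Then K(r, φ) → +∞ as (r, φ) leaves every compact subset of U; precisely, for every real L there exists a compact set C ⊆ U such that K(r, φ) > L for all (r, φ) ∈ U \ C. (Equivalently, K tends to +∞ along the cocompact filter of U.) -/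
open Set Real

/-- A lower bound for the curvature expression in the variables `r` and `s = sin (g φ)`. -/
theorem lt_curvature_of_mul_lt_exp {c r s b L M : ℝ} {n m : ℕ} (hm : 0 < m) (hc : 0 < c)
    (hr : 0 < r) (hs : 0 < s) (hs1 : s ≤ 1) (hb : 1 ≤ b) (hLM : L ≤ M)
    (h : M * (c ^ 2 * r ^ (2 * n) * s ^ 2) < exp (r ^ 2 / 2)) :
    L < exp (r ^ 2 / 2) / (c ^ 2 * r ^ (2 * n) * s ^ (2 * m)) * (r ^ 2 + b / s ^ 2) := by
  have hfactor : 1 ≤ r ^ 2 + b / s ^ 2 := by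
    have : 1 ≤ b / s ^ 2 := by
      rw [le_div_iff₀ (by positivity)]
      nlinarith
    nlinarith [sq_nonneg r]
  have hpow : s ^ (2 * m) ≤ s ^ 2 := pow_le_pow_of_le_one hs.le hs1 (by omega)
  calc L ≤ M := hLM
    _ < exp (r ^ 2 / 2) / (c ^ 2 * r ^ (2 * n) * s ^ 2) := by
      rwa [lt_div_iff₀ (by positivity)]
    _ ≤ exp (r ^ 2 / 2) / (c ^ 2 * r ^ (2 * n) * s ^ (2 * m)) := by gcongr
    _ ≤ _ := le_mul_of_one_le_right (by positivity) hfactor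

/-- Even powers are dominated by the Gaussian growth `exp (r ^ 2 / 2)`. -/
theorem pow_two_mul_le_exp (r : ℝ) (k : ℕ) :
    r ^ (2 * k) ≤ 2 ^ k * k.factorial * exp (r ^ 2 / 2) := by
  have h := Real.pow_div_factorial_le_exp (r ^ 2 / 2) (by positivity) k
  rw [div_pow, ← pow_mul, div_div, div_le_iff₀ (by positivity)] at h
  linarith

/-- Cutting off `r` and bounding `sin (g φ)` below gives a compact subset of the strip. -/
theorem isCompact_strip_cutoff {g : ℕ} (hg : 0 < g) {ε R δ : ℝ} (hε : 0 < ε) (hδ : 0 < δ) :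
    let C := (Icc ε R ×ˢ Icc (0 : ℝ) (π / g)) ∩ {p : ℝ × ℝ | δ ≤ sin (g * p.2)}
    C ⊆ Ioi (0 : ℝ) ×ˢ Ioo (0 : ℝ) (π / g) ∧ IsCompact C := by
  have hg' : (g : ℝ) ≠ 0 := by positivity
  refine ⟨?_, (isCompact_Icc.prod isCompact_Icc).inter_right
    (isClosed_le continuous_const (by fun_prop))⟩
  rintro ⟨r, φ⟩ ⟨⟨hr, hφ⟩, hs⟩
  simp only [mem_ofPred_eq] at hs hr hφ
  refine ⟨hε.trans_le hr.1, lt_of_le_of_ne hφ.1 ?_, lt_of_le_of_ne hφ.2 ?_⟩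
  · rintro rfl
    simp at hs
    linarith
  · rintro rfl
    rw [mul_div_cancel₀ _ hg', sin_pi] at hs
    linarith

/-- The Gaussian curvature `K` of the reduced metric tends to `+∞` as `(r, φ)` leaves
every compact subset of the strip `U = (0,∞) × (0, π/g)`. -/
theorem curvature_blows_up_at_boundary
    (g m : ℕ) (hg : 0 < g) (hm : 0 < m) (n : ℕ) (hn : n = m * g + 1)
    (c : ℝ) (hc : 0 < c)
    (K : ℝ → ℝ → ℝ)
    (hK : ∀ r φ : ℝ, K r φ =
      Real.exp (r ^ 2 / 2) / (c ^ 2 * r ^ (2 * n) * Real.sin (g * φ) ^ (2 * m)) *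
        (r ^ 2 + ((n : ℝ) - 1) * g / Real.sin (g * φ) ^ 2))
    (U : Set (ℝ × ℝ)) (hU : U = Ioi (0 : ℝ) ×ˢ Ioo (0 : ℝ) (π / g)) :
    ∀ L : ℝ, ∃ C : Set (ℝ × ℝ), C ⊆ U ∧ IsCompact C ∧
      ∀ p ∈ U \ C, L < K p.1 p.2 := by
  intro L
  subst hU
  set M : ℝ := |L| + 1
  have hMpos : 0 < M := by positivity
  have hLM : L ≤ M := by linarith [le_abs_self L]
  set A : ℝ := M * c ^ 2 with hA
  have hApos : 0 < A := by positivity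
  set D : ℝ := A * (2 ^ n * n.factorial) with hD
  have hDpos : 0 < D := by positivity
  set D' : ℝ := A * (2 ^ (n + 1) * (n + 1).factorial) with hD'
  have hD'pos : 0 < D' := by positivity
  obtain ⟨hCU, hC⟩ := isCompact_strip_cutoff hg (ε := 1 / (1 + A)) (R := 1 + D')
    (δ := 1 / (1 + D)) (by positivity) (by positivity)
  refine ⟨_, hCU, hC, ?_⟩
  rintro ⟨r, φ⟩ ⟨⟨hr, hφ⟩, hnot⟩
  simp only [mem_Ioi, mem_Ioo] at hr hφ
  have hg' : (0 : ℝ) < g := by positivity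
  have hs : 0 < sin (g * φ) := by
    refine sin_pos_of_pos_of_lt_pi (mul_pos hg' hφ.1) ?_
    have := (lt_div_iff₀ hg').1 hφ.2
    linarith
  have hb : 1 ≤ ((n : ℝ) - 1) * g := by
    have h : 1 ≤ m * g * g := Nat.mul_pos (Nat.mul_pos hm hg) hg
    have h' : (1 : ℝ) ≤ m * g * g := by exact_mod_cast h
    rw [hn]
    push_cast
    linarith
  have hs1 := sin_le_one (g * φ)
  simp only [hK]
  refine lt_curvature_of_mul_lt_exp hm hc hr hs hs1 hb hLM ?_
  set s := sin (g * φ)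
  have hexp : 1 ≤ exp (r ^ 2 / 2) := one_le_exp (by positivity)
  have hss : s ^ 2 ≤ s := by nlinarith
  have hrpow : 0 < r ^ (2 * n) := by positivity
  have hassoc : M * (c ^ 2 * r ^ (2 * n) * s ^ 2) = A * r ^ (2 * n) * s ^ 2 := by
    rw [hA]; ring
  rw [hassoc]
  have hdrop : A * r ^ (2 * n) * s ^ 2 ≤ A * r ^ (2 * n) :=
    mul_le_of_le_one_right (by positivity) (hss.trans hs1)
  by_cases hsmall : r < 1 / (1 + A)
  · have h := (lt_div_iff₀ (by positivity)).1 hsmall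
    have hr1 : r ≤ 1 := by nlinarith
    have hpow : r ^ (2 * n) ≤ r := pow_le_of_le_one hr.le hr1 (by omega)
    nlinarith [mul_le_mul_of_nonneg_left hpow hApos.le]
  by_cases hlarge : 1 + D' < r
  · have h := mul_le_mul_of_nonneg_left (pow_two_mul_le_exp r (n + 1)) hApos.le
    have h2 : A * r ^ (2 * n) * r ^ 2 ≤ D' * exp (r ^ 2 / 2) := by
      rw [hD']
      calc _ = A * r ^ (2 * (n + 1)) := by ring
        _ ≤ _ := h
        _ = _ := by ring
    have h3 : D' < r ^ 2 := by nlinarith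
    refine hdrop.trans_lt (lt_of_mul_lt_mul_right (h2.trans_lt ?_) (sq_nonneg r))
    nlinarith
  · have hsδ : s < 1 / (1 + D) := by
      by_contra! hge
      exact hnot ⟨⟨⟨not_lt.1 hsmall, not_lt.1 hlarge⟩, hφ.1.le, hφ.2.le⟩, hge⟩
    have h := (lt_div_iff₀ (by positivity)).1 hsδ
    have h1 : A * r ^ (2 * n) ≤ D * exp (r ^ 2 / 2) := by
      have := mul_le_mul_of_nonneg_left (pow_two_mul_le_exp r n) hApos.le
      rw [hD]
      linarith
    calc A * r ^ (2 * n) * s ^ 2 ≤ D * exp (r ^ 2 / 2) * s := by gcongr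
      _ = D * s * exp (r ^ 2 / 2) := by ring
      _ < 1 * exp (r ^ 2 / 2) := by gcongr; nlinarith
      _ = _ := one_mul _
end

section
/- Let F : ℝ² × ℝ² → ℝ² be a C¹ map satisfying the homogeneity property F(x, c·v) = c² F(x, v) for all x, v ∈ ℝ² and all c ∈ ℝ. Let γ : ℝ → ℝ² be a C² curve satisfying γ''(t) = F(γ(t), γ'(t)) for all t, with γ'(t) ≠ 0 for all t, and suppose γ is periodic with minimal positive period p (i.e., γ(t + p) = γ(t) for all t, and no smaller positive number is a period). If t₀, t₁ ∈ ℝ satisfy γ(t₀) = γ(t₁) and t₁ − t₀ ∉ pℤ, then γ'(t₀) and γ'(t₁) are linearly independent. -/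
open Function

/-- Two globally defined integral curves of a `C¹` autonomous vector field which agree at one time
agree everywhere. -/
theorem eq_of_hasDerivAt_of_contDiff {E : Type*} [NormedAddCommGroup E] [NormedSpace ℝ E]
    {V : E → E} (hV : ContDiff ℝ 1 V) {f g : ℝ → E}
    (hf : ∀ t, HasDerivAt f (V (f t)) t) (hg : ∀ t, HasDerivAt g (V (g t)) t)
    {a : ℝ} (ha : f a = g a) : f = g := by
  have hfc : Continuous f := continuous_iff_continuousAt.2 fun t => (hf t).continuousAt
  have hgc : Continuous g := continuous_iff_continuousAt.2 fun t => (hg t).continuousAt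
  have hopen : IsOpen {t | f t = g t} := by
    refine isOpen_iff_mem_nhds.2 fun t ht => ?_
    obtain ⟨K, s, hs, hK⟩ := (hV.contDiffAt (x := f t)).exists_lipschitzOnWith
    have hs' : s ∈ nhds (g t) := by rwa [← show f t = g t from ht]
    exact ODE_solution_unique_of_eventually (v := fun _ => V) (s := fun _ => s)
      (Filter.Eventually.of_forall fun _ => hK)
      ((hfc.continuousAt.eventually_mem hs).mono fun u hu => ⟨hf u, hu⟩)
      ((hgc.continuousAt.eventually_mem hs').mono fun u hu => ⟨hg u, hu⟩) ht
  have huniv := IsClopen.eq_univ ⟨isClosed_eq hfc hgc, hopen⟩ ⟨a, ha⟩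
  exact funext fun t => huniv.ge (Set.mem_univ t)

/-- Every period of a function is an integer multiple of its minimal positive period. -/
theorem Function.Periodic.exists_eq_mul_intCast_of_minimal {β : Type*} {f : ℝ → β} {p q : ℝ}
    (hp : 0 < p) (hper : Periodic f p) (hmin : ∀ r : ℝ, 0 < r → Periodic f r → p ≤ r)
    (hq : Periodic f q) : ∃ z : ℤ, q = p * z := by
  refine ⟨⌊q / p⌋, ?_⟩
  have hr : Periodic f (q - ⌊q / p⌋ * p) := hq.sub_period (hper.int_mul _)
  have hlo : (⌊q / p⌋ : ℝ) * p ≤ q := (le_div_iff₀ hp).1 (Int.floor_le _)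
  have hhi : q < (⌊q / p⌋ + 1 : ℝ) * p := (div_lt_iff₀ hp).1 (Int.lt_floor_add_one _)
  by_contra hne
  have hpos : 0 < q - ⌊q / p⌋ * p :=
    lt_of_le_of_ne (by linarith) fun h => hne (by linarith)
  linarith [hmin _ hpos hr]

/-- If a solution of a second-order ODE, quadratically homogeneous in the velocity, returns to a
point with velocity multiplied by `c`, then it retraces itself at `c` times the speed. -/
theorem eq_comp_affine_of_quadratic_ode {E : Type*} [NormedAddCommGroup E] [NormedSpace ℝ E]
    {F : E × E → E} (hF : ContDiff ℝ 1 F)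
    (hhom : ∀ (x v : E) (c : ℝ), F (x, c • v) = c ^ 2 • F (x, v))
    {γ : ℝ → E} (hγ : ContDiff ℝ 2 γ)
    (hode : ∀ t : ℝ, deriv (deriv γ) t = F (γ t, deriv γ t))
    {t₀ t₁ c : ℝ} (heq : γ t₁ = γ t₀) (hvel : deriv γ t₁ = c • deriv γ t₀) (s : ℝ) :
    γ (t₁ + s) = γ (t₀ + c * s) ∧ deriv γ (t₁ + s) = c • deriv γ (t₀ + c * s) := by
  have hd : ∀ t, HasDerivAt γ (deriv γ t) t := fun t =>
    (hγ.differentiable (by norm_num) t).hasDerivAt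
  have hd' : ∀ t, HasDerivAt (deriv γ) (F (γ t, deriv γ t)) t := fun t => by
    rw [← hode t]
    exact ((contDiff_succ_iff_deriv (n := 1)).1 hγ).2.2.differentiable (by norm_num) t
      |>.hasDerivAt
  have hV : ContDiff ℝ 1 fun y : E × E => (y.2, F y) := contDiff_snd.prodMk hF
  have haff (s : ℝ) : HasDerivAt (fun s => t₀ + c * s) c s := by
    simpa using ((hasDerivAt_id s).const_mul c).const_add t₀
  have hshift (s : ℝ) : HasDerivAt (fun s => t₁ + s) 1 s := (hasDerivAt_id s).const_add t₁
  have key : (fun s => (γ (t₁ + s), deriv γ (t₁ + s))) =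
      fun s => (γ (t₀ + c * s), c • deriv γ (t₀ + c * s)) := by
    refine eq_of_hasDerivAt_of_contDiff hV (a := 0) (fun s => ?_) (fun s => ?_) ?_
    · simpa using ((hd (t₁ + s)).scomp s (hshift s)).prodMk ((hd' (t₁ + s)).scomp s (hshift s))
    · have h := ((hd (t₀ + c * s)).scomp s (haff s)).prodMk
        (((hd' (t₀ + c * s)).scomp s (haff s)).const_smul c)
      rw [smul_smul, ← pow_two, ← hhom] at h
      exact h
    · simp [heq, hvel]
  exact Prod.ext_iff.1 (congrFun key s)


/-- A nonconstant periodic solution of a second-order ODE `γ'' = F(γ, γ')` with `F`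
quadratically homogeneous in the velocity (such as a geodesic equation) meets itself only
transversally: if `γ(t₀) = γ(t₁)` with `t₁ − t₀` not a multiple of the minimal period,
then `γ'(t₀)` and `γ'(t₁)` are linearly independent. -/
theorem self_intersections_of_periodic_quadratic_ode_are_transverse
    (F : (ℝ × ℝ) × (ℝ × ℝ) → ℝ × ℝ)
    (hF : ContDiff ℝ 1 F)
    (hhom : ∀ (x v : ℝ × ℝ) (c : ℝ), F (x, c • v) = c ^ 2 • F (x, v))
    (γ : ℝ → ℝ × ℝ)
    (hγ : ContDiff ℝ 2 γ)
    (hode : ∀ t : ℝ, deriv (deriv γ) t = F (γ t, deriv γ t))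
    (himm : ∀ t : ℝ, deriv γ t ≠ 0)
    (p : ℝ) (hp : 0 < p) (hper : Periodic γ p)
    (hmin : ∀ q : ℝ, 0 < q → Periodic γ q → p ≤ q)
    (t₀ t₁ : ℝ) (heq : γ t₀ = γ t₁)
    (hne : ∀ z : ℤ, t₁ - t₀ ≠ p * z) :
    LinearIndependent ℝ ![deriv γ t₀, deriv γ t₁] := by
  rw [LinearIndependent.pair_iff' (himm t₀)]
  intro c hc
  have hret := eq_comp_affine_of_quadratic_ode hF hhom hγ hode heq.symm hc.symm
  rcases eq_or_ne c 1 with rfl | hc1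
  · have hq : Periodic γ (t₁ - t₀) := fun t => by
      have h := (hret (t - t₀)).1
      rwa [one_mul, add_sub_cancel, show t₁ + (t - t₀) = t + (t₁ - t₀) by ring] at h
    obtain ⟨z, hz⟩ := hper.exists_eq_mul_intCast_of_minimal hp hmin hq
    exact hne z hz
  · have hc0 : c - 1 ≠ 0 := sub_ne_zero.2 hc1
    have h := (hret ((t₁ - t₀) / (c - 1))).2
    rw [show t₀ + c * ((t₁ - t₀) / (c - 1)) = t₁ + (t₁ - t₀) / (c - 1) by field_simp; ring] at h
    exact (smul_ne_zero hc0 (himm (t₁ + (t₁ - t₀) / (c - 1)))) (by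
      rw [sub_smul, one_smul, ← h, sub_self])
end
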